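/- arXiv:0704.3894 — 3 statements merged into one kernel-verified Lean document; each statement's English description precedes it below -/
import Mathlib

section
/- Every stable 3-form γ on ℝ^8 is equivalent to exactly one of the forms φ_1 = e^{124} + e^{134} + e^{256} + e^{378} + e^{157} + e^{468}, φ_2 = e^{135} + e^{245} + e^{146} − e^{236} + e^{127} + e^{348} + e^{678}, or φ_3 = e^{135} − e^{146} + e^{236} + e^{245} + e^{347} + e^{568} + e^{127} + e^{128}; that is, there exists g ∈ GL(8,ℝ) with g^*γ equal to one of φ_1, φ_2, φ_3. -/
noncomputable section

/-- The wedge product `f 0 ∧ ⋯ ∧ f (k-1)` of `k` covectors, as an alternating `k`-form: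
`(v₁,…,v_k) ↦ det (f i (v j))`. -/
def covectorWedge {V : Type*} [AddCommGroup V] [Module ℝ V] {k : ℕ}
    (f : Fin k → Module.Dual ℝ V) : V [⋀^Fin k]→ₗ[ℝ] ℝ :=
  (Matrix.detRowAlternating : (Fin k → ℝ) [⋀^Fin k]→ₗ[ℝ] ℝ).compLinearMap (LinearMap.pi f)

/-- The natural topology on the finite-dimensional space of alternating `k`-forms on `ℝⁿ`
(the topology induced by evaluation; it coincides with the standard vector space topology). -/
instance altFormTopology (n k : ℕ) :
    TopologicalSpace ((Fin n → ℝ) [⋀^Fin k]→ₗ[ℝ] ℝ) :=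
  TopologicalSpace.induced (fun φ => (⇑φ : (Fin k → Fin n → ℝ) → ℝ)) inferInstance

/-- The pullback `g^*γ` of a `k`-form on `ℝⁿ` by a linear map `g`:
`(g^*γ)(v₁,…,v_k) = γ (g v₁, …, g v_k)`. -/
def formPullback {n k : ℕ} (g : (Fin n → ℝ) →ₗ[ℝ] (Fin n → ℝ))
    (γ : (Fin n → ℝ) [⋀^Fin k]→ₗ[ℝ] ℝ) : (Fin n → ℝ) [⋀^Fin k]→ₗ[ℝ] ℝ :=
  γ.compLinearMap g

/-- A `k`-form on `ℝⁿ` is stable if its `GL(n,ℝ)`-orbit (under pullback) is open in the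
space of all alternating `k`-forms. -/
def IsStableForm {n k : ℕ} (γ : (Fin n → ℝ) [⋀^Fin k]→ₗ[ℝ] ℝ) : Prop :=
  IsOpen {φ : (Fin n → ℝ) [⋀^Fin k]→ₗ[ℝ] ℝ |
    ∃ g : (Fin n → ℝ) ≃ₗ[ℝ] (Fin n → ℝ), φ = formPullback g.toLinearMap γ}

/-- `e^i ∧ e^j ∧ e^k` on `ℝⁿ`, where `e^1,…,e^n` is the dual of the standard basis
(here indexed from `0`, so the paper's `e^{pqr}` is `eee (p-1) (q-1) (r-1)`). -/
def eee {n : ℕ} (i j k : Fin n) : (Fin n → ℝ) [⋀^Fin 3]→ₗ[ℝ] ℝ :=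
  covectorWedge ![LinearMap.proj i, LinearMap.proj j, LinearMap.proj k]

/-- The form `φ₁ = e^{124} + e^{134} + e^{256} + e^{378} + e^{157} + e^{468}` on `ℝ⁸`
(of `SL(3,ℝ)`-type, Djokovic's form XXIIIa). -/
def phiOne : (Fin 8 → ℝ) [⋀^Fin 3]→ₗ[ℝ] ℝ :=
  eee 0 1 3 + eee 0 2 3 + eee 1 4 5 + eee 2 6 7 + eee 0 4 6 + eee 3 5 7

/-- The form `φ₂ = e^{135} + e^{245} + e^{146} - e^{236} + e^{127} + e^{348} + e^{678}` on `ℝ⁸`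
(of `PSU(1,2)`-type, Djokovic's form XXIIIb). -/
def phiTwo : (Fin 8 → ℝ) [⋀^Fin 3]→ₗ[ℝ] ℝ :=
  eee 0 2 4 + eee 1 3 4 + eee 0 3 5 - eee 1 2 5 + eee 0 1 6 + eee 2 3 7 + eee 5 6 7

/-- The form `φ₃ = e^{135} - e^{146} + e^{236} + e^{245} + e^{347} + e^{568} + e^{127} + e^{128}`
on `ℝ⁸` (of `PSU(3)`-type, Djokovic's form XXIIIc). -/
def phiThree : (Fin 8 → ℝ) [⋀^Fin 3]→ₗ[ℝ] ℝ :=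
  eee 0 2 4 - eee 0 3 5 + eee 1 2 5 + eee 1 3 4 + eee 2 3 6 + eee 4 5 7 + eee 0 1 6 + eee 0 1 7

abbrev ThreeForm : Type := (Fin 8 → ℝ) [⋀^Fin 3]→ₗ[ℝ] ℝ

lemma eee_apply {n : ℕ} (i j k : Fin n) (x y z : Fin n → ℝ) :
    eee i j k ![x, y, z] = x i * (y j * z k - y k * z j) - x j * (y i * z k - y k * z i)
      + x k * (y i * z j - y j * z i) := by
  have key : ∀ f : Fin 3 → Fin 3 → ℝ, Matrix.detRowAlternating f = _ :=
    fun f => Matrix.det_fin_three (Matrix.of f)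
  rw [eee, covectorWedge, AlternatingMap.compLinearMap_apply, key]
  simp only [Matrix.of_apply, LinearMap.pi_apply, Matrix.cons_val, LinearMap.proj_apply]
  ring

lemma formPullback_apply {n : ℕ} (g : (Fin n → ℝ) →ₗ[ℝ] (Fin n → ℝ))
    (γ : (Fin n → ℝ) [⋀^Fin 3]→ₗ[ℝ] ℝ) (x y z : Fin n → ℝ) :
    formPullback g γ ![x, y, z] = γ ![g x, g y, g z] := by
  unfold formPullback
  rw [AlternatingMap.compLinearMap_apply]
  congr 1
  ext i : 1
  fin_cases i <;> rfl

namespace ThreeForm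

variable (γ : ThreeForm) (x y z w : Fin 8 → ℝ) (r : ℝ)

lemma swap_left : γ ![y, x, z] = -γ ![x, y, z] := by
  rw [← γ.map_swap ![x, y, z] (show (0 : Fin 3) ≠ 1 by decide)]
  congr 1
  ext i : 1
  fin_cases i <;> rfl

lemma swap_right : γ ![x, z, y] = -γ ![x, y, z] := by
  rw [← γ.map_swap ![x, y, z] (show (1 : Fin 3) ≠ 2 by decide)]
  congr 1
  ext i : 1
  fin_cases i <;> rfl

lemma rotate : γ ![y, z, x] = γ ![x, y, z] := by
  rw [swap_right, swap_left, neg_neg]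

lemma add_fst : γ ![x + w, y, z] = γ ![x, y, z] + γ ![w, y, z] :=
  γ.map_vecCons_add _ _ _

lemma smul_fst : γ ![r • x, y, z] = r * γ ![x, y, z] :=
  γ.map_vecCons_smul _ _ _

lemma add_snd : γ ![x, y + w, z] = γ ![x, y, z] + γ ![x, w, z] := by
  simp only [← rotate γ x, add_fst]

lemma smul_snd : γ ![x, r • y, z] = r * γ ![x, y, z] := by
  simp only [← rotate γ x, smul_fst]

lemma add_trd : γ ![x, y, z + w] = γ ![x, y, z] + γ ![x, y, w] := by
  rw [← rotate γ x, ← rotate γ y, add_fst, rotate γ z, rotate γ w]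

lemma smul_trd : γ ![x, y, r • z] = r * γ ![x, y, z] := by
  rw [← rotate γ x, ← rotate γ y, smul_fst, rotate γ z]

lemma self_fst : γ ![x, x, y] = 0 :=
  γ.map_eq_zero_of_eq _ (i := 0) (j := 1) rfl (by decide)

lemma self_snd : γ ![x, y, y] = 0 :=
  γ.map_eq_zero_of_eq _ (i := 1) (j := 2) rfl (by decide)

lemma self_outer : γ ![x, y, x] = 0 :=
  γ.map_eq_zero_of_eq _ (i := 0) (j := 2) rfl (by decide)

/-- The linear form `z ↦ γ(x, y, z)`. -/
def slot : (Fin 8 → ℝ) →ₗ[ℝ] ℝ where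
  toFun z := γ ![x, y, z]
  map_add' z w := add_trd γ x y z w
  map_smul' r z := smul_trd γ x y z r

/-- The `i`-th standard basis vector of `ℝ⁸`. -/
abbrev e (i : Fin 8) : Fin 8 → ℝ := Pi.single i 1

lemma expand_trd : γ ![x, y, z] = ∑ i, z i * γ ![x, y, e i] := by
  have h := LinearMap.pi_apply_eq_sum_univ (slot γ x y) z
  simp only [smul_eq_mul] at h
  refine h.trans (Finset.sum_congr rfl fun i _ => ?_)
  congr 1
  change γ _ = γ _
  congr 3
  ext j
  simp [Pi.single_apply, eq_comm]

variable {γ}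

lemma ext_basis {δ : ThreeForm} (h : ∀ i j k, γ ![e i, e j, e k] = δ ![e i, e j, e k]) :
    γ = δ := by
  refine Module.Basis.ext_alternating (Pi.basisFun ℝ (Fin 8)) fun v _ => ?_
  have : (fun i => Pi.basisFun ℝ (Fin 8) (v i)) = ![e (v 0), e (v 1), e (v 2)] := by
    ext i : 1
    fin_cases i <;> simp
  rw [this]
  exact h _ _ _

lemma ext_apply {δ : ThreeForm} (h : ∀ x y z, γ ![x, y, z] = δ ![x, y, z]) : γ = δ :=
  ext_basis fun _ _ _ => h _ _ _

/-- The orbit of `γ` under the general linear group. -/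
def orbit (γ : ThreeForm) : Set ThreeForm :=
  {φ | ∃ g : (Fin 8 → ℝ) ≃ₗ[ℝ] (Fin 8 → ℝ), φ = formPullback g.toLinearMap γ}

lemma mem_orbit_self (γ : ThreeForm) : γ ∈ orbit γ :=
  ⟨LinearEquiv.refl ℝ _, ext_apply fun x y z => by rw [formPullback_apply]; rfl⟩

lemma pullback_mem_orbit {δ : ThreeForm} (h : δ ∈ orbit γ)
    (g : (Fin 8 → ℝ) →ₗ[ℝ] (Fin 8 → ℝ)) (hg : ∀ x, g x = 0 → x = 0) :
    formPullback g δ ∈ orbit γ := by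
  obtain ⟨f, rfl⟩ := h
  have hinj : Function.Injective g := (injective_iff_map_eq_zero g).2 hg
  exact ⟨(LinearEquiv.ofInjectiveEndo g hinj).trans f, ext_apply fun x y z => by
    simp [formPullback_apply]⟩

lemma eventually_mem_orbit (hγ : IsStableForm γ) {δ : ThreeForm} (h : δ ∈ orbit γ)
    (ψ : ThreeForm) : ∀ᶠ t in nhds (0 : ℝ), δ + t • ψ ∈ orbit γ := by
  have hc : Continuous fun t : ℝ => δ + t • ψ := by
    rw [continuous_induced_rng, continuous_pi_iff]
    intro v
    change Continuous fun t : ℝ => δ v + t * ψ v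
    fun_prop
  refine hc.continuousAt.eventually (IsOpen.mem_nhds hγ ?_)
  simpa using h

/-- A point of the orbit can be moved in any direction while avoiding a negligible set. -/
lemma exists_perturbation (hγ : IsStableForm γ) {δ : ThreeForm} (h : δ ∈ orbit γ)
    (ψ : ThreeForm) {p : ℝ → Prop} (hp : ∀ᶠ t in nhdsWithin (0 : ℝ) {0}ᶜ, p t) :
    ∃ t, δ + t • ψ ∈ orbit γ ∧ p t :=
  (((eventually_mem_orbit hγ h ψ).filter_mono nhdsWithin_le_nhds).and hp).exists

end ThreeForm

lemma eventually_quadratic_ne_zero (a b c : ℝ) (h : a ≠ 0 ∨ b ≠ 0 ∨ c ≠ 0) :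
    ∀ᶠ t in nhdsWithin (0 : ℝ) {0}ᶜ, a * t ^ 2 + b * t + c ≠ 0 := by
  by_cases hc : c = 0
  · subst hc
    by_cases hb : b = 0
    · subst hb
      have ha : a ≠ 0 := by simpa using h
      filter_upwards [self_mem_nhdsWithin] with t ht
      simpa using ⟨ha, ht⟩
    · have h1 : ∀ᶠ t in nhds (0 : ℝ), a * t + b ≠ 0 := by
        have : ContinuousAt (fun t : ℝ => a * t + b) 0 := by fun_prop
        exact this.eventually_ne (by simpa using hb)
      filter_upwards [self_mem_nhdsWithin, h1.filter_mono nhdsWithin_le_nhds] with t ht h2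
      have : a * t ^ 2 + b * t + 0 = t * (a * t + b) := by ring
      rw [this]
      exact mul_ne_zero ht h2
  · have : ContinuousAt (fun t : ℝ => a * t ^ 2 + b * t + c) 0 := by fun_prop
    exact (this.eventually_ne (by simpa using hc)).filter_mono nhdsWithin_le_nhds

/-- The Pfaffian of a skew-symmetric `6 × 6` matrix, read off its upper triangle. -/
def pfaffianSix (m : Fin 6 → Fin 6 → ℝ) : ℝ :=
  m 0 1 * (m 2 3 * m 4 5 - m 2 4 * m 3 5 + m 2 5 * m 3 4)
    - m 0 2 * (m 1 3 * m 4 5 - m 1 4 * m 3 5 + m 1 5 * m 3 4)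
    + m 0 3 * (m 1 2 * m 4 5 - m 1 4 * m 2 5 + m 1 5 * m 2 4)
    - m 0 4 * (m 1 2 * m 3 5 - m 1 3 * m 2 5 + m 1 5 * m 2 3)
    + m 0 5 * (m 1 2 * m 3 4 - m 1 3 * m 2 4 + m 1 4 * m 2 3)

set_option maxHeartbeats 2000000 in
lemma det_skew_six_eq_sq (a b c d e f g h i j k l m n o : ℝ) :
    (!![0, a, b, c, d, e; -a, 0, f, g, h, i; -b, -f, 0, j, k, l; -c, -g, -j, 0, m, n;
      -d, -h, -k, -m, 0, o; -e, -i, -l, -n, -o, 0]).det =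
    (a * (j * o - k * n + l * m) - b * (g * o - h * n + i * m) + c * (f * o - h * l + i * k)
      - d * (f * n - g * l + i * j) + e * (f * m - g * k + h * j)) ^ 2 := by
  simp [Matrix.det_succ_row_zero, Fin.sum_univ_succ, Fin.succAbove]
  ring

lemma det_eq_pfaffianSix_sq (m : Fin 6 → Fin 6 → ℝ) (hm : ∀ i j, m j i = -m i j) :
    (Matrix.of m).det = pfaffianSix m ^ 2 := by
  have h0 : ∀ i, m i i = 0 := fun i => by linarith [hm i i]
  rw [pfaffianSix, ← det_skew_six_eq_sq]
  congr 1
  ext i j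
  fin_cases i <;> fin_cases j <;> simp [h0] <;> exact hm _ _

lemma det_eq_zero_of_skew_of_odd {n : ℕ} (hn : Odd n) (M : Matrix (Fin n) (Fin n) ℝ)
    (hM : M.transpose = -M) : M.det = 0 := by
  have h := M.det_transpose
  rw [hM, Matrix.det_neg, Fintype.card_fin, hn.neg_one_pow] at h
  linarith

lemma exists_mem_ker_of_det_block_eq_zero {k n : ℕ} (M : Matrix (Fin (k + n)) (Fin (k + n)) ℝ)
    (h0 : ∀ i : Fin (k + n), i.val < k → ∀ j, M i j = 0)
    (hdet : (M.submatrix (Fin.natAdd k) (Fin.natAdd k)).det = 0) :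
    ∃ w ≠ 0, (∀ i : Fin (k + n), i.val < k → w i = 0) ∧ Matrix.mulVec M w = 0 := by
  obtain ⟨v, hv, hMv⟩ := Matrix.exists_mulVec_eq_zero_iff.2 hdet
  refine ⟨Fin.append 0 v, ?_, ?_, ?_⟩
  · intro h
    refine hv (funext fun i => ?_)
    simpa using congrFun h (Fin.natAdd k i)
  · intro i hi
    have : i = Fin.castAdd n ⟨i.val, hi⟩ := rfl
    rw [this, Fin.append_left]
    rfl
  · ext i
    rw [Matrix.mulVec, dotProduct, Fin.sum_univ_add]
    simp only [Fin.append_left, Fin.append_right, Pi.zero_apply, mul_zero,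
      Finset.sum_const_zero, zero_add]
    refine Fin.addCases (fun i => ?_) (fun i => ?_) i
    · exact Finset.sum_eq_zero fun j _ => by rw [h0 _ i.isLt, zero_mul]
    · exact congrFun hMv i

namespace ThreeForm

variable {γ : ThreeForm}

/-- The matrix of the `2`-form `γ(x, ·, ·)`. -/
def contractionMatrix (γ : ThreeForm) (x : Fin 8 → ℝ) : Matrix (Fin 8) (Fin 8) ℝ :=
  Matrix.of fun i j => γ ![x, e i, e j]

lemma contractionMatrix_transpose (γ : ThreeForm) (x : Fin 8 → ℝ) :
    (contractionMatrix γ x).transpose = -contractionMatrix γ x := by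
  ext i j
  exact swap_right γ x (e i) (e j)

lemma eq_zero_of_basis {x y : Fin 8 → ℝ} (h : ∀ i, γ ![x, y, e i] = 0) (z : Fin 8 → ℝ) :
    γ ![x, y, z] = 0 := by
  rw [expand_trd]
  exact Finset.sum_eq_zero fun i _ => by rw [h, mul_zero]

lemma eq_zero_of_mem_ker {x w : Fin 8 → ℝ}
    (h : Matrix.mulVec (contractionMatrix γ x) w = 0) (z : Fin 8 → ℝ) :
    γ ![x, w, z] = 0 := by
  refine eq_zero_of_basis (fun i => ?_) z
  rw [swap_right, expand_trd, neg_eq_zero]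
  exact (Finset.sum_congr rfl fun j _ => mul_comm _ _).trans (congrFun h i)

lemma exists_linearMap_single_eq (k : Fin 8) (w : Fin 8 → ℝ) (hw : w ≠ 0)
    (h : ∀ i : Fin 8, i.val < k.val → w i = 0) :
    ∃ g : (Fin 8 → ℝ) →ₗ[ℝ] (Fin 8 → ℝ), (∀ x, g x = 0 → x = 0) ∧
      (∀ i : Fin 8, i.val < k.val → g (e i) = e i) ∧ g (e k) = w := by
  obtain ⟨j, hj⟩ := Function.ne_iff.1 hw
  have hjk : k ≤ j := by
    by_contra hlt
    exact hj (h j (by simpa using hlt))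
  let s : (Fin 8 → ℝ) →ₗ[ℝ] (Fin 8 → ℝ) :=
    LinearMap.id + (LinearMap.toSpanSingleton ℝ _ (w - e j)).comp (LinearMap.proj j)
  have hs : ∀ x, s x = x + x j • (w - e j) := fun x => by simp [s]
  let σ : (Fin 8 → ℝ) →ₗ[ℝ] (Fin 8 → ℝ) := LinearMap.funLeft ℝ ℝ (Equiv.swap k j)
  have hσ : ∀ i, σ (e i) = e (Equiv.swap k j i) := fun i => by
    ext l
    simp only [σ, LinearMap.funLeft_apply, Pi.single_apply]
    congr 1
    rw [Equiv.swap_apply_eq_iff]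
  refine ⟨s.comp σ, fun x hx => ?_, fun i hi => ?_, ?_⟩
  · have h1 : σ x j = 0 := by
      have := congrFun (hs (σ x)) j
      rw [LinearMap.comp_apply] at hx
      rw [hx] at this
      have h2 : σ x j * w j = 0 := by
        simp at this
        linarith
      exact (mul_eq_zero.1 h2).resolve_right hj
    have h2 : σ x = 0 := by
      have := hs (σ x)
      rw [h1, zero_smul, add_zero] at this
      rw [← this]
      exact hx
    ext i
    have := congrFun h2 (Equiv.swap k j i)
    simpa [σ, LinearMap.funLeft_apply] using this
  · have hik : i ≠ k := fun h => by simp [h] at hi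
    have hij : i ≠ j := fun h => by
      subst h
      exact absurd hjk (by simpa using hi)
    rw [LinearMap.comp_apply, hσ, Equiv.swap_apply_of_ne_of_ne hik hij, hs]
    simp [hij]
  · rw [LinearMap.comp_apply, hσ, Equiv.swap_apply_left, hs]
    simp

lemma exists_moved_vector {δ : ThreeForm} (hδ : δ ∈ orbit γ) (k : Fin 8) (x w : Fin 8 → ℝ)
    (hw : w ≠ 0) (hx : ∀ i : Fin 8, k.val ≤ i.val → x i = 0)
    (h0 : ∀ i : Fin 8, i.val < k.val → w i = 0) (hker : ∀ z, δ ![x, w, z] = 0) :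
    ∃ η ∈ orbit γ, (∀ z, η ![x, e k, z] = 0) ∧
      ∀ i j : Fin 8, i.val < k.val → j.val < k.val → (∀ z, δ ![e i, e j, z] = 0) →
        ∀ z, η ![e i, e j, z] = 0 := by
  obtain ⟨g, hg, hge, hgk⟩ := exists_linearMap_single_eq k w hw h0
  refine ⟨formPullback g δ, pullback_mem_orbit hδ g hg, fun z => ?_, fun i j hi hj h z => ?_⟩
  · have hgx : g x = x := by
      have hsum : x = ∑ i, x i • e i := pi_eq_sum_univ' x
      conv_lhs => rw [hsum, map_sum]
      conv_rhs => rw [hsum]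
      refine Finset.sum_congr rfl fun i _ => ?_
      rw [map_smul]
      by_cases hi : i.val < k.val
      · rw [hge i hi]
      · rw [hx i (not_lt.1 hi), zero_smul, zero_smul]
    rw [formPullback_apply, hgx, hgk, hker]
  · rw [formPullback_apply, hge i hi, hge j hj, h]

lemma exists_mem_orbit_ker_two (γ : ThreeForm) :
    ∃ δ ∈ orbit γ, ∀ z, δ ![e 0, e 1, z] = 0 := by
  obtain ⟨w, hw, hw0, hker⟩ := exists_mem_ker_of_det_block_eq_zero (k := 1) (n := 7)
    (contractionMatrix γ (e 0))
    (fun i hi j => by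
      obtain rfl : i = 0 := Fin.ext (by simpa using hi)
      exact self_fst γ _ _)
    (det_eq_zero_of_skew_of_odd (by decide) _ (by
      rw [Matrix.transpose_submatrix, contractionMatrix_transpose]
      rfl))
  obtain ⟨δ, hδ, h1, -⟩ := exists_moved_vector (mem_orbit_self γ) 1 (e 0) w hw
    (fun i hi => Pi.single_eq_of_ne (fun h => by simp [h] at hi) _) hw0
    (eq_zero_of_mem_ker hker)
  exact ⟨δ, hδ, h1⟩

/-- The rotation of the plane spanned by the first two basis vectors. -/
def rotation (θ : ℝ) : (Fin 8 → ℝ) →ₗ[ℝ] (Fin 8 → ℝ) where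
  toFun x i := if i = 0 then Real.cos θ * x 0 - Real.sin θ * x 1
    else if i = 1 then Real.sin θ * x 0 + Real.cos θ * x 1 else x i
  map_add' x y := by
    ext i
    simp only [Pi.add_apply]
    split_ifs <;> ring
  map_smul' r x := by
    ext i
    simp only [Pi.smul_apply, smul_eq_mul, RingHom.id_apply]
    split_ifs <;> ring

lemma rotation_injective (θ : ℝ) (x : Fin 8 → ℝ) (h : rotation θ x = 0) : x = 0 := by
  have h0 : Real.cos θ * x 0 - Real.sin θ * x 1 = 0 := congrFun h 0
  have h1 : Real.sin θ * x 0 + Real.cos θ * x 1 = 0 := congrFun h 1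
  have hθ := Real.sin_sq_add_cos_sq θ
  ext i
  by_cases hi0 : i = 0
  · subst hi0
    change x 0 = 0
    linear_combination Real.cos θ * h0 + Real.sin θ * h1 - x 0 * hθ
  by_cases hi1 : i = 1
  · subst hi1
    change x 1 = 0
    linear_combination Real.cos θ * h1 - Real.sin θ * h0 - x 1 * hθ
  · simpa [rotation, hi0, hi1] using congrFun h i

lemma exists_pfaffianSix_eq_zero (A B : Fin 6 → Fin 6 → ℝ) :
    ∃ θ : ℝ, pfaffianSix (fun i j => Real.cos θ * A i j + Real.sin θ * B i j) = 0 := by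
  have hc : Continuous fun θ : ℝ =>
      pfaffianSix (fun i j => Real.cos θ * A i j + Real.sin θ * B i j) := by
    unfold pfaffianSix
    fun_prop
  set f := fun θ : ℝ => pfaffianSix (fun i j => Real.cos θ * A i j + Real.sin θ * B i j)
  have hneg : f Real.pi = -f 0 := by
    simp only [f, pfaffianSix, Real.cos_pi, Real.sin_pi, Real.cos_zero, Real.sin_zero]
    ring
  have : (0 : ℝ) ∈ Set.range f := by
    rcases le_total (f 0) 0 with h | h
    · exact mem_range_of_exists_le_of_exists_ge hc ⟨0, h⟩ ⟨Real.pi, by linarith⟩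
    · exact mem_range_of_exists_le_of_exists_ge hc ⟨Real.pi, by linarith⟩ ⟨0, h⟩
  exact this

lemma exists_mem_orbit_ker_three (γ : ThreeForm) :
    ∃ δ ∈ orbit γ, (∀ z, δ ![e 0, e 1, z] = 0) ∧ ∀ z, δ ![e 0, e 2, z] = 0 := by
  obtain ⟨δ, hδ, h01⟩ := exists_mem_orbit_ker_two γ
  have h10 : ∀ z, δ ![e 1, e 0, z] = 0 := fun z => by rw [swap_left, h01, neg_zero]
  obtain ⟨θ, hθ⟩ := exists_pfaffianSix_eq_zero
    (fun i j => δ ![e 0, e (Fin.natAdd 2 i), e (Fin.natAdd 2 j)])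
    (fun i j => δ ![e 1, e (Fin.natAdd 2 i), e (Fin.natAdd 2 j)])
  set x : Fin 8 → ℝ := Real.cos θ • e 0 + Real.sin θ • e 1 with hx
  have hx' : ∀ y z, δ ![x, y, z] =
      Real.cos θ * δ ![e 0, y, z] + Real.sin θ * δ ![e 1, y, z] := fun y z => by
    rw [hx, add_fst, smul_fst, smul_fst]
  obtain ⟨w, hw, hw0, hker⟩ := exists_mem_ker_of_det_block_eq_zero (k := 2) (n := 6)
    (contractionMatrix δ x)
    (fun i hi j => by
      change δ ![x, e i, e j] = 0
      rw [hx']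
      obtain h | h : i.val = 0 ∨ i.val = 1 := by omega
      · obtain rfl : i = (0 : Fin 8) := Fin.ext h
        rw [self_fst, h10]
        simp
      · obtain rfl : i = (1 : Fin 8) := Fin.ext h
        rw [self_fst, h01]
        simp)
    (by
      simp only [← hx'] at hθ
      refine (det_eq_pfaffianSix_sq _ fun i j => swap_right δ x _ _).trans ?_
      rw [hθ]
      simp)
  obtain ⟨η, hη, h1, h2⟩ := exists_moved_vector hδ 2 x w hw
    (fun i hi => by
      have h0 : i ≠ 0 := fun h => by simp [h] at hi
      have h1 : i ≠ 1 := fun h => by simp [h] at hi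
      simp [hx, h0, h1]) hw0
    (eq_zero_of_mem_ker hker)
  replace h2 := h2 0 1 (by decide) (by decide) h01
  have hr0 : rotation θ (e 0) = x := by
    ext i
    fin_cases i <;> simp [rotation, hx]
  have hr1 : rotation θ (e 1) = -Real.sin θ • e 0 + Real.cos θ • e 1 := by
    ext i
    fin_cases i <;> simp [rotation]
  have hr2 : rotation θ (e 2) = e 2 := by
    ext i
    fin_cases i <;> simp [rotation]
  refine ⟨formPullback (rotation θ) η, pullback_mem_orbit hη _ (rotation_injective θ),
    fun z => ?_, fun z => ?_⟩
  · rw [formPullback_apply, hr0, hr1, hx]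
    simp only [add_fst, smul_fst, add_snd, smul_snd, self_fst, h2, swap_left η (e 0) (e 1)]
    ring
  · rw [formPullback_apply, hr0, hr2, h1]

/-- Every orbit contains a form with a vector contracting to a `2`-form of rank at most four. -/
lemma exists_mem_orbit_ker_four (γ : ThreeForm) :
    ∃ δ ∈ orbit γ, ∀ i : Fin 8, i.val < 4 → ∀ z, δ ![e 0, e i, z] = 0 := by
  obtain ⟨δ, hδ, h01, h02⟩ := exists_mem_orbit_ker_three γ
  obtain ⟨w, hw, hw0, hker⟩ := exists_mem_ker_of_det_block_eq_zero (k := 3) (n := 5)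
    (contractionMatrix δ (e 0))
    (fun i hi j => by
      change δ ![e 0, e i, e j] = 0
      obtain h | h | h : i.val = 0 ∨ i.val = 1 ∨ i.val = 2 := by omega
      · obtain rfl : i = (0 : Fin 8) := Fin.ext h
        exact self_fst _ _ _
      · obtain rfl : i = (1 : Fin 8) := Fin.ext h
        exact h01 _
      · obtain rfl : i = (2 : Fin 8) := Fin.ext h
        exact h02 _)
    (det_eq_zero_of_skew_of_odd (by decide) _ (by
      rw [Matrix.transpose_submatrix, contractionMatrix_transpose]
      rfl))
  obtain ⟨η, hη, h1, h2⟩ := exists_moved_vector hδ 3 (e 0) w hw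
    (fun i hi => Pi.single_eq_of_ne (fun h => by simp [h] at hi) _) hw0
    (eq_zero_of_mem_ker hker)
  refine ⟨η, hη, fun i hi => ?_⟩
  obtain rfl | rfl | rfl | rfl : i = 0 ∨ i = 1 ∨ i = 2 ∨ i = 3 := by omega
  · exact fun z => self_fst _ _ _
  · exact h2 0 1 (by decide) (by decide) h01
  · exact h2 0 2 (by decide) (by decide) h02
  · exact h1

/-- The first half of the coordinates. -/
def head : (Fin 8 → ℝ) →ₗ[ℝ] (Fin 4 → ℝ) := LinearMap.funLeft ℝ ℝ (Fin.castAdd 4)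

/-- The second half of the coordinates. -/
def tail : (Fin 8 → ℝ) →ₗ[ℝ] (Fin 4 → ℝ) := LinearMap.funLeft ℝ ℝ (Fin.natAdd 4)

/-- The vector with prescribed halves. -/
def join (y z : Fin 4 → ℝ) : Fin 8 → ℝ := Fin.append y z

@[simp] lemma head_join (y z : Fin 4 → ℝ) : head (join y z) = y :=
  funext fun i => Fin.append_left y z i

@[simp] lemma tail_join (y z : Fin 4 → ℝ) : tail (join y z) = z :=
  funext fun i => Fin.append_right y z i

lemma halves_ext {x y : Fin 8 → ℝ} (h : head x = head y) (h' : tail x = tail y) : x = y :=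
  funext fun i => Fin.addCases (m := 4) (n := 4) (motive := fun i => x i = y i)
    (fun i => congrFun h i) (fun i => congrFun h' i) i

/-- The linear map acting on the two halves by two matrices. -/
def blockMap (R h : Matrix (Fin 4) (Fin 4) ℝ) : (Fin 8 → ℝ) →ₗ[ℝ] (Fin 8 → ℝ) where
  toFun x := join (R.mulVec (head x)) (h.mulVec (tail x))
  map_add' x y := halves_ext (by simp [Matrix.mulVec_add]) (by simp [Matrix.mulVec_add])
  map_smul' r x := halves_ext (by simp [Matrix.mulVec_smul]) (by simp [Matrix.mulVec_smul])

@[simp] lemma head_blockMap (R h : Matrix (Fin 4) (Fin 4) ℝ) (x : Fin 8 → ℝ) :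
    head (blockMap R h x) = R.mulVec (head x) := head_join _ _

@[simp] lemma tail_blockMap (R h : Matrix (Fin 4) (Fin 4) ℝ) (x : Fin 8 → ℝ) :
    tail (blockMap R h x) = h.mulVec (tail x) := tail_join _ _

lemma blockMap_injective {R h : Matrix (Fin 4) (Fin 4) ℝ} (hR : R.det ≠ 0) (hh : h.det ≠ 0)
    (x : Fin 8 → ℝ) (hx : blockMap R h x = 0) : x = 0 := by
  refine halves_ext ?_ ?_
  · rw [map_zero]
    refine Matrix.eq_zero_of_mulVec_eq_zero hR ?_
    rw [← head_blockMap R h, hx, map_zero]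
  · rw [map_zero]
    refine Matrix.eq_zero_of_mulVec_eq_zero hh ?_
    rw [← tail_blockMap R h, hx, map_zero]

/-- The alternating bilinear form attached to (the skew part of) a matrix. -/
def skewPairing (M : Matrix (Fin 4) (Fin 4) ℝ) (y z : Fin 4 → ℝ) : ℝ :=
  (y ⬝ᵥ M.mulVec z - z ⬝ᵥ M.mulVec y) / 2

lemma skewPairing_conj (M h : Matrix (Fin 4) (Fin 4) ℝ) (y z : Fin 4 → ℝ) :
    skewPairing (h.transpose * M * h) y z = skewPairing M (h.mulVec y) (h.mulVec z) := by
  have key (y z : Fin 4 → ℝ) : y ⬝ᵥ (h.transpose * M * h).mulVec z = h.mulVec y ⬝ᵥ M.mulVec (h.mulVec z) := by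
    rw [← Matrix.mulVec_mulVec, ← Matrix.mulVec_mulVec, Matrix.dotProduct_mulVec,
      Matrix.vecMul_transpose]
  rw [skewPairing, skewPairing, key, key]

lemma skewPairing_sum {ι : Type*} (s : Finset ι) (r : ι → ℝ) (M : ι → Matrix (Fin 4) (Fin 4) ℝ)
    (y z : Fin 4 → ℝ) :
    skewPairing (∑ i ∈ s, r i • M i) y z = ∑ i ∈ s, r i * skewPairing (M i) y z := by
  simp only [skewPairing, Matrix.sum_mulVec, Matrix.smul_mulVec, dotProduct_sum,
    dotProduct_smul, smul_eq_mul, ← Finset.sum_sub_distrib, Finset.sum_div]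
  exact Finset.sum_congr rfl fun i _ => by ring

lemma skewPairing_single (M : Matrix (Fin 4) (Fin 4) ℝ) (i j : Fin 4) :
    skewPairing M (Pi.single i 1) (Pi.single j 1) = (M i j - M j i) / 2 := by
  simp [skewPairing]

@[simp] lemma skewPairing_zero_left (M : Matrix (Fin 4) (Fin 4) ℝ) (y : Fin 4 → ℝ) :
    skewPairing M 0 y = 0 := by simp [skewPairing]

@[simp] lemma skewPairing_zero_right (M : Matrix (Fin 4) (Fin 4) ℝ) (y : Fin 4 → ℝ) :
    skewPairing M y 0 = 0 := by simp [skewPairing]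

/-- The `3`-form `c e¹ ∧ e² ∧ e³ + ∑ eᵃ ∧ Wₐ`, where `Wₐ` is a `2`-form in the last four
coordinates. -/
def blockForm (c : ℝ) (W : Fin 4 → Matrix (Fin 4) (Fin 4) ℝ) : ThreeForm :=
  c • eee 1 2 3 +
    ∑ a, ∑ i, ∑ j, (W a i j / 2) • eee (n := 8) (Fin.castAdd 4 a) (Fin.natAdd 4 i) (Fin.natAdd 4 j)

/-- The determinant of the last three coordinates. -/
def volThree (x y z : Fin 4 → ℝ) : ℝ :=
  x 1 * (y 2 * z 3 - y 3 * z 2) - x 2 * (y 1 * z 3 - y 3 * z 1)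
    + x 3 * (y 1 * z 2 - y 2 * z 1)

lemma sum_apply {ι : Type*} (s : Finset ι) (f : ι → ThreeForm) (v : Fin 3 → Fin 8 → ℝ) :
    (∑ i ∈ s, f i) v = ∑ i ∈ s, f i v := by
  classical
  induction s using Finset.induction_on with
  | empty => simp
  | insert i s hi ih => simp [Finset.sum_insert hi, ih]

lemma blockForm_apply (c : ℝ) (W : Fin 4 → Matrix (Fin 4) (Fin 4) ℝ) (x y z : Fin 8 → ℝ) :
    blockForm c W ![x, y, z] = c * volThree (head x) (head y) (head z) +
      ∑ a, (head x a * skewPairing (W a) (tail y) (tail z)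
        - head y a * skewPairing (W a) (tail x) (tail z)
        + head z a * skewPairing (W a) (tail x) (tail y)) := by
  simp only [blockForm, AlternatingMap.add_apply, AlternatingMap.smul_apply,
    sum_apply, eee_apply, smul_eq_mul]
  congr 1
  refine Finset.sum_congr rfl fun a _ => ?_
  simp only [skewPairing, dotProduct, Matrix.mulVec, Fin.sum_univ_four, head, tail,
    LinearMap.funLeft_apply]
  ring

lemma blockForm_add_smul (c c' t : ℝ) (W W' : Fin 4 → Matrix (Fin 4) (Fin 4) ℝ) :
    blockForm c W + t • blockForm c' W' = blockForm (c + t * c') (W + t • W') := by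
  simp only [blockForm, smul_add, Finset.smul_sum, smul_smul, Pi.add_apply, Pi.smul_apply,
    Matrix.add_apply, Matrix.smul_apply, smul_eq_mul, add_div, add_smul, Finset.sum_add_distrib,
    mul_div_assoc]
  abel

lemma pullback_blockForm (c : ℝ) (W : Fin 4 → Matrix (Fin 4) (Fin 4) ℝ)
    (R h : Matrix (Fin 4) (Fin 4) ℝ) (hR : ∀ i : Fin 3, R i.succ 0 = 0) :
    formPullback (blockMap R h) (blockForm c W) =
      blockForm (c * (R.submatrix Fin.succ Fin.succ).det)
        fun j => ∑ i, R i j • (h.transpose * W i * h) := by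
  have h1 : R 1 0 = 0 := hR 0
  have h2 : R 2 0 = 0 := hR 1
  have h3 : R 3 0 = 0 := hR 2
  refine ext_apply fun x y z => ?_
  rw [formPullback_apply, blockForm_apply, blockForm_apply]
  simp only [head_blockMap, tail_blockMap, ← skewPairing_conj, skewPairing_sum]
  congr 1
  · simp only [volThree, Matrix.mulVec, dotProduct, Fin.sum_univ_four, h1, h2, h3,
      Matrix.det_fin_three, Matrix.submatrix_apply, Fin.reduceSucc, zero_mul, zero_add]
    change _ = c * (R 1 1 * R 2 2 * R 3 3 - R 1 1 * R 2 3 * R 3 2 - R 1 2 * R 2 1 * R 3 3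
      + R 1 2 * R 2 3 * R 3 1 + R 1 3 * R 2 1 * R 3 2 - R 1 3 * R 2 2 * R 3 1) * _
    ring
  · simp only [Matrix.mulVec, dotProduct, Fin.sum_univ_four]
    ring

lemma blockForm_mem_orbit {c : ℝ} {W : Fin 4 → Matrix (Fin 4) (Fin 4) ℝ}
    (hW : blockForm c W ∈ orbit γ) (R h : Matrix (Fin 4) (Fin 4) ℝ)
    (hR : ∀ i : Fin 3, R i.succ 0 = 0) (hRd : R.det ≠ 0) (hh : h.det ≠ 0) :
    blockForm (c * (R.submatrix Fin.succ Fin.succ).det)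
        (fun j => ∑ i, R i j • (h.transpose * W i * h)) ∈ orbit γ := by
  rw [← pullback_blockForm c W R h hR]
  exact pullback_mem_orbit hW _ (blockMap_injective hRd hh)

lemma eq_zero_of_increasing {v : Fin 4 → Fin 8 → ℝ} (h0 : γ ![v 0, v 1, v 2] = 0)
    (h1 : γ ![v 0, v 1, v 3] = 0) (h2 : γ ![v 0, v 2, v 3] = 0) (h3 : γ ![v 1, v 2, v 3] = 0)
    (i j k : Fin 4) : γ ![v i, v j, v k] = 0 := by
  fin_cases i <;> fin_cases j <;> fin_cases k <;>
  first
  | exact self_fst _ _ _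
  | exact self_snd _ _ _
  | exact self_outer _ _ _
  | assumption
  | (rw [swap_left, neg_eq_zero]; assumption)
  | (rw [swap_right, neg_eq_zero]; assumption)
  | (rw [rotate]; assumption)
  | (rw [← rotate]; assumption)
  | (rw [swap_left, rotate, neg_eq_zero]; assumption)

lemma eq_of_increasing {δ : ThreeForm} {v : Fin 4 → Fin 8 → ℝ}
    (h0 : γ ![v 0, v 1, v 2] = δ ![v 0, v 1, v 2])
    (h1 : γ ![v 0, v 1, v 3] = δ ![v 0, v 1, v 3])
    (h2 : γ ![v 0, v 2, v 3] = δ ![v 0, v 2, v 3])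
    (h3 : γ ![v 1, v 2, v 3] = δ ![v 1, v 2, v 3])
    (i j k : Fin 4) : γ ![v i, v j, v k] = δ ![v i, v j, v k] :=
  sub_eq_zero.1 (eq_zero_of_increasing (γ := γ - δ) (sub_eq_zero.2 h0) (sub_eq_zero.2 h1)
    (sub_eq_zero.2 h2) (sub_eq_zero.2 h3) i j k)

lemma ext_halves {δ : ThreeForm}
    (h0 : ∀ a b c : Fin 4, γ ![e (Fin.castAdd 4 a), e (Fin.castAdd 4 b), e (Fin.castAdd 4 c)] =
      δ ![e (Fin.castAdd 4 a), e (Fin.castAdd 4 b), e (Fin.castAdd 4 c)])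
    (h1 : ∀ a b i : Fin 4, γ ![e (Fin.castAdd 4 a), e (Fin.castAdd 4 b), e (Fin.natAdd 4 i)] =
      δ ![e (Fin.castAdd 4 a), e (Fin.castAdd 4 b), e (Fin.natAdd 4 i)])
    (h2 : ∀ a i j : Fin 4, γ ![e (Fin.castAdd 4 a), e (Fin.natAdd 4 i), e (Fin.natAdd 4 j)] =
      δ ![e (Fin.castAdd 4 a), e (Fin.natAdd 4 i), e (Fin.natAdd 4 j)])
    (h3 : ∀ i j k : Fin 4, γ ![e (Fin.natAdd 4 i), e (Fin.natAdd 4 j), e (Fin.natAdd 4 k)] =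
      δ ![e (Fin.natAdd 4 i), e (Fin.natAdd 4 j), e (Fin.natAdd 4 k)]) : γ = δ := by
  refine ext_basis fun i j k => ?_
  induction i using Fin.addCases (m := 4) (n := 4) <;>
  induction j using Fin.addCases (m := 4) (n := 4) <;>
  induction k using Fin.addCases (m := 4) (n := 4)
  · exact h0 _ _ _
  · exact h1 _ _ _
  · rw [swap_right γ, swap_right δ, h1]
  · exact h2 _ _ _
  · rw [← rotate γ, ← rotate δ, h1]
  · rw [swap_left γ, swap_left δ, h2]
  · rw [rotate γ, rotate δ, h2]
  · exact h3 _ _ _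

lemma head_castAdd (a : Fin 4) : head (e (Fin.castAdd 4 a)) = Pi.single a 1 := by
  fin_cases a <;> ext i <;> fin_cases i <;> simp [head, LinearMap.funLeft_apply]

lemma tail_castAdd (a : Fin 4) : tail (e (Fin.castAdd 4 a)) = 0 := by
  fin_cases a <;> ext i <;> fin_cases i <;> simp [tail, LinearMap.funLeft_apply]

lemma head_natAdd (a : Fin 4) : head (e (Fin.natAdd 4 a)) = 0 := by
  fin_cases a <;> ext i <;> fin_cases i <;> simp [head, LinearMap.funLeft_apply]

lemma tail_natAdd (a : Fin 4) : tail (e (Fin.natAdd 4 a)) = Pi.single a 1 := by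
  fin_cases a <;> ext i <;> fin_cases i <;> simp [tail, LinearMap.funLeft_apply]

/-- The skew-symmetric `4 × 4` matrix with prescribed upper triangle. -/
def skew (a b c d e f : ℝ) : Matrix (Fin 4) (Fin 4) ℝ :=
  !![0, a, b, c; -a, 0, d, e; -b, -d, 0, f; -c, -e, -f, 0]

lemma eq_skew {M : Matrix (Fin 4) (Fin 4) ℝ} (h : ∀ i j, M j i = -M i j) :
    M = skew (M 0 1) (M 0 2) (M 0 3) (M 1 2) (M 1 3) (M 2 3) := by
  have h0 : ∀ i, M i i = 0 := fun i => by linarith [h i i]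
  ext i j
  fin_cases i <;> fin_cases j <;> simp [skew, h0] <;> exact h _ _

lemma eq_blockForm {δ : ThreeForm} (h0 : ∀ a z, δ ![e 0, e (Fin.castAdd 4 a), z] = 0)
    (h1 : ∀ a b i : Fin 4,
      δ ![e (Fin.castAdd 4 a), e (Fin.castAdd 4 b), e (Fin.natAdd 4 i)] = 0)
    (h2 : ∀ i j k : Fin 4,
      δ ![e (Fin.natAdd 4 i), e (Fin.natAdd 4 j), e (Fin.natAdd 4 k)] = 0) :
    δ = blockForm (δ ![e 1, e 2, e 3]) fun a =>
      Matrix.of fun i j => δ ![e (Fin.castAdd 4 a), e (Fin.natAdd 4 i), e (Fin.natAdd 4 j)] := by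
  refine ext_halves (fun a b c => ?_) (fun a b i => ?_) (fun a i j => ?_) (fun i j k => ?_)
  · refine eq_of_increasing (v := fun a => e (Fin.castAdd 4 a)) ?_ ?_ ?_ ?_ a b c
    · rw [blockForm_apply]
      simp only [head_castAdd, tail_castAdd]
      simp [volThree]
      exact h0 1 _
    · rw [blockForm_apply]
      simp only [head_castAdd, tail_castAdd]
      simp [volThree]
      exact h0 1 _
    · rw [blockForm_apply]
      simp only [head_castAdd, tail_castAdd]
      simp [volThree]
      exact h0 2 _
    · rw [blockForm_apply]
      simp only [head_castAdd, tail_castAdd]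
      simp [volThree]
  · rw [blockForm_apply, h1]
    simp only [head_castAdd, tail_castAdd, head_natAdd, tail_natAdd]
    simp [volThree]
  · rw [blockForm_apply]
    simp only [head_castAdd, tail_castAdd, head_natAdd, tail_natAdd, skewPairing_single]
    simp only [volThree, Pi.zero_apply, mul_zero, Matrix.of_apply,
      skewPairing_zero_left, zero_mul, sub_zero, add_zero, zero_add,
      Pi.single_apply, ite_mul, one_mul, Finset.sum_ite_eq', Finset.mem_univ, if_true]
    rw [swap_right δ _ (e (Fin.natAdd 4 i)) (e (Fin.natAdd 4 j))]
    ring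
  · rw [blockForm_apply, h2]
    simp only [head_natAdd, tail_natAdd]
    simp [volThree]

/-- The Pfaffian of a skew-symmetric `4 × 4` matrix, read off its upper triangle. -/
def pfaffianFour (m : Fin 4 → Fin 4 → ℝ) : ℝ :=
  m 0 1 * m 2 3 - m 0 2 * m 1 3 + m 0 3 * m 1 2

lemma exists_mem_orbit_nondegenerate (hγ : IsStableForm γ) :
    ∃ δ ∈ orbit γ, (∀ a z, δ ![e 0, e (Fin.castAdd 4 a), z] = 0) ∧ δ ![e 1, e 2, e 3] ≠ 0 ∧
      pfaffianFour (fun i j : Fin 4 => δ ![e 0, e (Fin.natAdd 4 i), e (Fin.natAdd 4 j)]) ≠ 0 := by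
  obtain ⟨δ, hδ, h0⟩ := exists_mem_orbit_ker_four γ
  set ω := fun i j : Fin 4 => δ ![e 0, e (Fin.natAdd 4 i), e (Fin.natAdd 4 j)] with hω
  obtain ⟨t, ht, h1, h2⟩ := exists_perturbation hγ hδ
    (eee 1 2 3 + eee 0 4 5 + eee 0 6 7)
    ((eventually_quadratic_ne_zero 0 1 (δ ![e 1, e 2, e 3]) (by simp)).and
      (eventually_quadratic_ne_zero 1 (ω 0 1 + ω 2 3) (pfaffianFour ω) (by simp)))
  refine ⟨_, ht, fun a z => ?_, ?_, ?_⟩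
  · simp only [AlternatingMap.add_apply, AlternatingMap.smul_apply, eee_apply,
      h0 (Fin.castAdd 4 a) a.isLt z]
    fin_cases a <;> simp
  · simp only [AlternatingMap.add_apply, AlternatingMap.smul_apply, eee_apply]
    convert h1 using 1
    simp
    ring
  · convert h2 using 1
    simp only [pfaffianFour, AlternatingMap.add_apply, AlternatingMap.smul_apply, eee_apply, hω]
    simp [Fin.natAdd]
    ring

/-- The shear fixing the first four basis vectors and adding combinations of them to the
last four. -/
def shear (m : Matrix (Fin 4) (Fin 4) ℝ) : (Fin 8 → ℝ) →ₗ[ℝ] (Fin 8 → ℝ) where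
  toFun x := join (head x + m.mulVec (tail x)) (tail x)
  map_add' x y := halves_ext (by simp [Matrix.mulVec_add]; abel) (by simp)
  map_smul' r x := halves_ext (by simp [Matrix.mulVec_smul]) (by simp)

lemma shear_injective (m : Matrix (Fin 4) (Fin 4) ℝ) (x : Fin 8 → ℝ) (h : shear m x = 0) :
    x = 0 := by
  have h1 : tail x = 0 := by simpa [shear] using congrArg tail h
  have h2 : head x = 0 := by simpa [shear, h1] using congrArg head h
  exact halves_ext (by rw [h2, map_zero]) (by rw [h1, map_zero])

lemma shear_castAdd (m : Matrix (Fin 4) (Fin 4) ℝ) (a : Fin 4) :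
    shear m (e (Fin.castAdd 4 a)) = e (Fin.castAdd 4 a) :=
  halves_ext (by simp [shear, tail_castAdd]) (by simp [shear])

lemma shear_natAdd (m : Matrix (Fin 4) (Fin 4) ℝ) (i : Fin 4) :
    shear m (e (Fin.natAdd 4 i)) =
      e (Fin.natAdd 4 i) + ∑ a, m a i • e (Fin.castAdd 4 a) := by
  refine halves_ext ?_ ?_
  · simp only [shear, LinearMap.coe_mk, AddHom.coe_mk, head_join, map_add, map_sum, map_smul,
      head_castAdd, head_natAdd, tail_natAdd]
    ext b
    simp [Pi.single_apply]
  · simp [shear, tail_castAdd]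

lemma exists_mem_orbit_head_head_tail (hγ : IsStableForm γ) :
    ∃ δ ∈ orbit γ, (∀ a z, δ ![e 0, e (Fin.castAdd 4 a), z] = 0) ∧
      (∀ a b i : Fin 4, δ ![e (Fin.castAdd 4 a), e (Fin.castAdd 4 b), e (Fin.natAdd 4 i)] = 0) ∧
      δ ![e 1, e 2, e 3] ≠ 0 ∧
      pfaffianFour (fun i j : Fin 4 => δ ![e 0, e (Fin.natAdd 4 i), e (Fin.natAdd 4 j)]) ≠ 0 := by
  obtain ⟨δ, hδ, h0, hD, hpf⟩ := exists_mem_orbit_nondegenerate hγ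
  set D := δ ![e 1, e 2, e 3] with hDdef
  let m : Matrix (Fin 4) (Fin 4) ℝ := Matrix.of ![0,
    fun i => -δ ![e 2, e 3, e (Fin.natAdd 4 i)] / D,
    fun i => δ ![e 1, e 3, e (Fin.natAdd 4 i)] / D,
    fun i => -δ ![e 1, e 2, e (Fin.natAdd 4 i)] / D]
  have hZ (a : Fin 4) : shear m (e (Fin.castAdd 4 a)) = e (Fin.castAdd 4 a) := shear_castAdd m a
  have hU (i : Fin 4) : shear m (e (Fin.natAdd 4 i)) =
      e (Fin.natAdd 4 i) + (m 1 i • e 1 + m 2 i • e 2 + m 3 i • e 3) := by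
    rw [shear_natAdd, Fin.sum_univ_four, show m 0 i = 0 from rfl, zero_smul, zero_add]
    rfl
  have h12 (i : Fin 4) : δ ![e 1, e 2, shear m (e (Fin.natAdd 4 i))] = 0 := by
    rw [hU]
    simp only [add_trd, smul_trd, self_snd, self_outer, ← hDdef]
    simp [m, hD]
  have h13 (i : Fin 4) : δ ![e 1, e 3, shear m (e (Fin.natAdd 4 i))] = 0 := by
    rw [hU]
    simp only [add_trd, smul_trd, self_snd, self_outer, swap_right δ (e 1) (e 2) (e 3), ← hDdef]
    simp [m, hD]
  have h23 (i : Fin 4) : δ ![e 2, e 3, shear m (e (Fin.natAdd 4 i))] = 0 := by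
    rw [hU]
    simp only [add_trd, smul_trd, self_snd, self_outer, rotate δ (e 1) (e 2) (e 3), ← hDdef]
    simp [m, hD]
  refine ⟨formPullback (shear m) δ, pullback_mem_orbit hδ _ (shear_injective m),
    fun a z => ?_, fun a b i => ?_, ?_, ?_⟩
  · rw [formPullback_apply, hZ a]
    exact (congrArg (fun x => δ ![x, e (Fin.castAdd 4 a), shear m z]) (hZ 0)).trans (h0 a _)
  · rw [formPullback_apply, hZ a, hZ b]
    fin_cases a <;> fin_cases b <;>
    first
    | exact self_fst _ _ _
    | exact h0 1 _
    | exact h0 2 _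
    | exact h0 3 _
    | exact h12 i
    | exact h13 i
    | exact h23 i
    | (rw [swap_left, neg_eq_zero]; first
        | exact h0 1 _
        | exact h0 2 _
        | exact h0 3 _
        | exact h12 i
        | exact h13 i
        | exact h23 i)
  · rw [formPullback_apply]
    have : δ ![shear m (e 1), shear m (e 2), shear m (e 3)] = D := by
      rw [hDdef]
      congr 3
      · exact hZ 1
      · exact hZ 2
      · exact congrArg (fun x => ![x]) (hZ 3)
    rwa [this]
  · convert hpf using 4 with i j
    rw [formPullback_apply, show shear m (e 0) = e 0 from hZ 0, hU, hU]
    have h0' (a : Fin 4) (z : Fin 8 → ℝ) : δ ![e 0, z, e (Fin.castAdd 4 a)] = 0 := by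
      rw [swap_right, h0, neg_zero]
    have := h0 1
    have := h0 2
    have := h0 3
    have := h0' 1
    have := h0' 2
    have := h0' 3
    simp only [Fin.reduceCastAdd] at *
    simp only [add_snd, smul_snd, add_trd, smul_trd, *]
    ring

/-- Every stable orbit contains a form which is block-decomposed along a splitting of `ℝ⁸`. -/
lemma exists_blockForm_mem_orbit (hγ : IsStableForm γ) :
    ∃ c W, blockForm c W ∈ orbit γ ∧ c ≠ 0 ∧ (∀ a i j, W a j i = -W a i j) ∧
      pfaffianFour (fun i j => W 0 i j) ≠ 0 := by
  obtain ⟨δ, hδ, h0, h1, hD, hpf⟩ := exists_mem_orbit_head_head_tail hγ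
  set ω := fun i j : Fin 4 => δ ![e 0, e (Fin.natAdd 4 i), e (Fin.natAdd 4 j)] with hω
  set p := pfaffianFour ω with hp
  let u : Fin 4 → Fin 8 → ℝ := fun i => e (Fin.natAdd 4 i)
  let k : Fin 4 → ℝ := ![
    -(ω 0 3 * δ ![u 0, u 1, u 2] - ω 0 2 * δ ![u 0, u 1, u 3] + ω 0 1 * δ ![u 0, u 2, u 3]) / p,
    -(ω 1 3 * δ ![u 0, u 1, u 2] - ω 1 2 * δ ![u 0, u 1, u 3] + ω 0 1 * δ ![u 1, u 2, u 3]) / p,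
    -(ω 2 3 * δ ![u 0, u 1, u 2] - ω 1 2 * δ ![u 0, u 2, u 3] + ω 0 2 * δ ![u 1, u 2, u 3]) / p,
    -(ω 2 3 * δ ![u 0, u 1, u 3] - ω 1 3 * δ ![u 0, u 2, u 3] + ω 0 3 * δ ![u 1, u 2, u 3]) / p]
  let m : Matrix (Fin 4) (Fin 4) ℝ := Matrix.of ![k, 0, 0, 0]
  have hZ (a : Fin 4) : shear m (e (Fin.castAdd 4 a)) = e (Fin.castAdd 4 a) := shear_castAdd m a
  have hU (i : Fin 4) : shear m (e (Fin.natAdd 4 i)) = u i + k i • e 0 := by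
    rw [shear_natAdd, Fin.sum_univ_four]
    simp [m, u]
  have hτ (i j l : Fin 4) : δ ![u i + k i • e 0, u j + k j • e 0, u l + k l • e 0] =
      δ ![u i, u j, u l] + k i * ω j l - k j * ω i l + k l * ω i j := by
    simp only [add_fst, smul_fst, add_snd, smul_snd, add_trd, smul_trd, self_fst, self_snd,
      self_outer, swap_left δ (e 0) (u i), rotate δ (e 0) (u i) (u j)]
    simp only [hω, u]
    ring
  have hmem := pullback_mem_orbit hδ _ (shear_injective m)
  rw [eq_blockForm (δ := formPullback (shear m) δ) (fun a z => by
    rw [formPullback_apply, hZ a]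
    exact (congrArg (fun x => δ ![x, e (Fin.castAdd 4 a), shear m z]) (hZ 0)).trans (h0 a _))
    (fun a b i => by
      rw [formPullback_apply, hZ a, hZ b, hU, add_trd, smul_trd, h1, rotate, h0]
      simp)
    (fun i j l => by
      rw [formPullback_apply, hU, hU, hU]
      refine eq_zero_of_increasing (v := fun i => u i + k i • e 0) ?_ ?_ ?_ ?_ i j l
      all_goals
        rw [hτ]
        simp only [k, Matrix.cons_val]
        field_simp
        simp only [hp, pfaffianFour]
        ring)] at hmem
  refine ⟨_, _, hmem, ?_, fun a i j => by
    simp only [Matrix.of_apply]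
    exact swap_right _ _ _ _, ?_⟩
  · rw [formPullback_apply]
    have : δ ![shear m (e 1), shear m (e 2), shear m (e 3)] = δ ![e 1, e 2, e 3] := by
      congr 3
      · exact hZ 1
      · exact hZ 2
      · exact congrArg (fun x => ![x]) (hZ 3)
    rwa [this]
  · simp only [Matrix.of_apply]
    convert hpf using 4 with i j
    rw [formPullback_apply, hZ, hU, hU]
    change δ ![e 0, _, _] = _
    simp only [add_snd, smul_snd, add_trd, smul_trd, self_fst, self_outer]
    simp [hω, u]

/-- The orbit of `γ` contains a block form with the given blocks and a nonzero cubic term. -/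
def HasBlocks (γ : ThreeForm) (A B C D : Matrix (Fin 4) (Fin 4) ℝ) : Prop :=
  ∃ c ≠ 0, blockForm c ![A, B, C, D] ∈ orbit γ

variable {A B C D : Matrix (Fin 4) (Fin 4) ℝ}

lemma HasBlocks.conj (H : HasBlocks γ A B C D) (h : Matrix (Fin 4) (Fin 4) ℝ) (hh : h.det ≠ 0) :
    HasBlocks γ (h.transpose * A * h) (h.transpose * B * h) (h.transpose * C * h)
      (h.transpose * D * h) := by
  obtain ⟨c, hc, H⟩ := H
  have := blockForm_mem_orbit H 1 h (fun i => Matrix.one_apply_ne (Fin.succ_ne_zero i)) (by simp) hh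
  refine ⟨_, hc, ?_⟩
  convert this using 2
  · rw [Matrix.submatrix_one _ (Fin.succ_injective _), Matrix.det_one, mul_one]
  · ext j
    fin_cases j <;> simp [Matrix.one_apply]

lemma HasBlocks.conj_of (H : HasBlocks γ A B C D) (h : Matrix (Fin 4) (Fin 4) ℝ)
    {A' B' C' D' : Matrix (Fin 4) (Fin 4) ℝ} (hh : h.det ≠ 0) (hA : h.transpose * A * h = A')
    (hB : h.transpose * B * h = B') (hC : h.transpose * C * h = C')
    (hD : h.transpose * D * h = D') : HasBlocks γ A' B' C' D' := by
  subst hA hB hC hD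
  exact H.conj h hh

lemma HasBlocks.combine (H : HasBlocks γ A B C D) (R : Matrix (Fin 4) (Fin 4) ℝ)
    (hR : ∀ i : Fin 3, R i.succ 0 = 0) (hRd : R.det ≠ 0) :
    HasBlocks γ (R 0 0 • A) (R 0 1 • A + R 1 1 • B + R 2 1 • C + R 3 1 • D)
      (R 0 2 • A + R 1 2 • B + R 2 2 • C + R 3 2 • D)
      (R 0 3 • A + R 1 3 • B + R 2 3 • C + R 3 3 • D) := by
  obtain ⟨c, hc, H⟩ := H
  have := blockForm_mem_orbit H R 1 hR hRd (by simp)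
  refine ⟨c * (R.submatrix Fin.succ Fin.succ).det, mul_ne_zero hc fun h0 => hRd ?_, ?_⟩
  · rw [Matrix.det_succ_column_zero, Fin.sum_univ_succ]
    simp [hR, h0]
  · convert this using 2
    ext j
    have h1 : R 1 0 = 0 := hR 0
    have h2 : R 2 0 = 0 := hR 1
    have h3 : R 3 0 = 0 := hR 2
    fin_cases j <;> simp [Fin.sum_univ_four, h1, h2, h3]

/-- Replace the second block by a combination of all blocks. -/
lemma HasBlocks.combine_snd (H : HasBlocks γ A B C D) (k : Fin 4 → ℝ) (hk : k 1 ≠ 0) :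
    HasBlocks γ A (k 0 • A + k 1 • B + k 2 • C + k 3 • D) C D := by
  have := H.combine !![1, k 0, 0, 0; 0, k 1, 0, 0; 0, k 2, 1, 0; 0, k 3, 0, 1]
    (by intro i; fin_cases i <;> rfl)
    (by simpa [Matrix.det_succ_row_zero, Fin.sum_univ_succ, Fin.succAbove] using hk)
  simpa using this

/-- Rescale all blocks. -/
lemma HasBlocks.scale (H : HasBlocks γ A B C D) (s : Fin 4 → ℝ) (hs : ∀ i, s i ≠ 0) :
    HasBlocks γ (s 0 • A) (s 1 • B) (s 2 • C) (s 3 • D) := by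
  have := H.combine (Matrix.diagonal s)
    (fun i => Matrix.diagonal_apply_ne _ (Fin.succ_ne_zero i))
    (by simpa [Matrix.det_diagonal, Fin.prod_univ_four] using
      ⟨⟨⟨hs 0, hs 1⟩, hs 2⟩, hs 3⟩)
  simpa [Matrix.diagonal_apply] using this

/-- Add combinations of the preceding blocks to the last three. -/
lemma HasBlocks.shear (H : HasBlocks γ A B C D) (b0 c0 c1 d0 d1 d2 : ℝ) :
    HasBlocks γ A (B + b0 • A) (C + c0 • A + c1 • B) (D + d0 • A + d1 • B + d2 • C) := by
  have := H.combine !![1, b0, c0, d0; 0, 1, c1, d1; 0, 0, 1, d2; 0, 0, 0, 1]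
    (by intro i; fin_cases i <;> rfl)
    (by simp [Matrix.det_succ_row_zero, Fin.sum_univ_succ, Fin.succAbove])
  simp only [Matrix.of_apply, Matrix.cons_val, one_smul, zero_smul, add_zero] at this
  convert this using 1 <;> abel

lemma HasBlocks.perturb (hγ : IsStableForm γ) (H : HasBlocks γ A B C D)
    (A' B' C' D' : Matrix (Fin 4) (Fin 4) ℝ) {p : ℝ → Prop}
    (hp : ∀ᶠ t in nhdsWithin (0 : ℝ) {0}ᶜ, p t) :
    ∃ t, p t ∧ HasBlocks γ (A + t • A') (B + t • B') (C + t • C') (D + t • D') := by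
  obtain ⟨c, hc, H⟩ := H
  obtain ⟨t, ht, hpt⟩ := exists_perturbation hγ H (blockForm 0 ![A', B', C', D']) hp
  refine ⟨t, hpt, c, hc, ?_⟩
  rw [blockForm_add_smul] at ht
  simpa using ht

lemma smul_skew (r a b c d e f : ℝ) :
    r • skew a b c d e f = skew (r * a) (r * b) (r * c) (r * d) (r * e) (r * f) := by
  ext i j
  fin_cases i <;> fin_cases j <;> simp [skew]

lemma skew_add_skew (a b c d e f a' b' c' d' e' f' : ℝ) :
    skew a b c d e f + skew a' b' c' d' e' f' =
      skew (a + a') (b + b') (c + c') (d + d') (e + e') (f + f') := by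
  ext i j
  fin_cases i <;> fin_cases j <;> simp [skew] <;> ring

lemma transpose_mul_skew_mul (h : Matrix (Fin 4) (Fin 4) ℝ) (a b c d e f : ℝ) :
    let q (i j : Fin 4) := a * (h 0 i * h 1 j - h 1 i * h 0 j) + b * (h 0 i * h 2 j - h 2 i * h 0 j)
      + c * (h 0 i * h 3 j - h 3 i * h 0 j) + d * (h 1 i * h 2 j - h 2 i * h 1 j)
      + e * (h 1 i * h 3 j - h 3 i * h 1 j) + f * (h 2 i * h 3 j - h 3 i * h 2 j)
    h.transpose * skew a b c d e f * h =
      skew (q 0 1) (q 0 2) (q 0 3) (q 1 2) (q 1 3) (q 2 3) := by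
  intro q
  ext i j
  fin_cases i <;> fin_cases j <;>
    simp [q, skew, Matrix.mul_apply, Fin.sum_univ_four] <;> ring

lemma skewPairing_skew (a b c d e f : ℝ) (y z : Fin 4 → ℝ) :
    skewPairing (skew a b c d e f) y z = a * (y 0 * z 1 - y 1 * z 0) + b * (y 0 * z 2 - y 2 * z 0)
      + c * (y 0 * z 3 - y 3 * z 0) + d * (y 1 * z 2 - y 2 * z 1) + e * (y 1 * z 3 - y 3 * z 1)
      + f * (y 2 * z 3 - y 3 * z 2) := by
  simp [skewPairing, skew, dotProduct, Matrix.mulVec, Fin.sum_univ_four]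
  ring

lemma exists_skew_eq_conj (h : Matrix (Fin 4) (Fin 4) ℝ) (a b c d e f : ℝ) :
    ∃ v : Fin 6 → ℝ, h.transpose * skew a b c d e f * h =
      skew (v 0) (v 1) (v 2) (v 3) (v 4) (v 5) :=
  ⟨![_, _, _, _, _, _], transpose_mul_skew_mul h a b c d e f⟩

lemma exists_hasBlocks (hγ : IsStableForm γ) :
    ∃ b c d : Fin 6 → ℝ, HasBlocks γ (skew 1 0 0 0 0 1) (skew (b 0) (b 1) (b 2) (b 3) (b 4) (b 5))
      (skew (c 0) (c 1) (c 2) (c 3) (c 4) (c 5)) (skew (d 0) (d 1) (d 2) (d 3) (d 4) (d 5)) := by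
  obtain ⟨k, W, hW, hk, hskew, hpf⟩ := exists_blockForm_mem_orbit hγ
  have H : HasBlocks γ (W 0) (W 1) (W 2) (W 3) := by
    refine ⟨k, hk, ?_⟩
    convert hW using 2
    ext a
    fin_cases a <;> rfl
  rw [eq_skew (hskew 0), eq_skew (hskew 1), eq_skew (hskew 2), eq_skew (hskew 3)] at H
  simp only [pfaffianFour] at hpf
  obtain ⟨t, ⟨ha, hp⟩, H⟩ := H.perturb hγ (skew 1 0 0 0 0 0) 0 0 0
    ((eventually_quadratic_ne_zero 0 1 (W 0 0 1) (by simp)).and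
      (eventually_quadratic_ne_zero 0 (W 0 2 3)
        (W 0 0 1 * W 0 2 3 - W 0 0 2 * W 0 1 3 + W 0 0 3 * W 0 1 2) (Or.inr (Or.inr hpf))))
  simp only [smul_zero, add_zero, smul_skew, skew_add_skew, mul_one, mul_zero] at H
  generalize W 0 0 2 = b at *
  generalize W 0 0 3 = c at *
  generalize W 0 1 2 = d at *
  generalize W 0 1 3 = e at *
  generalize W 0 2 3 = f at *
  set a := W 0 0 1 + t with hadef
  set p := a * f - b * e + c * d with hpdef
  replace ha : a ≠ 0 := by
    convert ha using 1
    ring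
  replace hp : p ≠ 0 := by
    convert hp using 1
    rw [hpdef, hadef]
    ring
  obtain ⟨b', hb'⟩ := exists_skew_eq_conj
    !![1 / a, 0, d / p, e / a; 0, 1, -b / p, -c / a; 0, 0, a / p, 0; 0, 0, 0, 1]
    (W 1 0 1) (W 1 0 2) (W 1 0 3) (W 1 1 2) (W 1 1 3) (W 1 2 3)
  obtain ⟨c', hc'⟩ := exists_skew_eq_conj
    !![1 / a, 0, d / p, e / a; 0, 1, -b / p, -c / a; 0, 0, a / p, 0; 0, 0, 0, 1]
    (W 2 0 1) (W 2 0 2) (W 2 0 3) (W 2 1 2) (W 2 1 3) (W 2 2 3)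
  obtain ⟨d', hd'⟩ := exists_skew_eq_conj
    !![1 / a, 0, d / p, e / a; 0, 1, -b / p, -c / a; 0, 0, a / p, 0; 0, 0, 0, 1]
    (W 3 0 1) (W 3 0 2) (W 3 0 3) (W 3 1 2) (W 3 1 3) (W 3 2 3)
  refine ⟨b', c', d', H.conj_of _ ?_ ?_ hb' hc' hd'⟩
  · simp [Matrix.det_succ_row_zero, Fin.sum_univ_succ, Fin.succAbove, ha, hp]
  · rw [transpose_mul_skew_mul]
    congr 1 <;> simp <;> field_simp <;> (try simp only [hpdef]) <;> ring

lemma exists_hasBlocks_traceless (hγ : IsStableForm γ) :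
    ∃ (a b c : ℝ) (u v : Fin 6 → ℝ), 0 < a ∧
      HasBlocks γ (skew 1 0 0 0 0 1) (skew a b c (-c) b (-a))
        (skew (u 0) (u 1) (u 2) (u 3) (u 4) (u 5)) (skew (v 0) (v 1) (v 2) (v 3) (v 4) (v 5)) := by
  obtain ⟨w, u, v, H⟩ := exists_hasBlocks hγ
  obtain ⟨t, ht, H⟩ := H.perturb hγ 0 0 (skew 0 1 0 0 0 0) (skew 0 0 1 0 0 0)
    (eventually_quadratic_ne_zero 1 (u 1 - u 4 + (v 2 + v 3))
      ((u 1 - u 4) * (v 2 + v 3) - (v 1 - v 4) * (u 2 + u 3)) (by simp))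
  simp only [smul_zero, add_zero, smul_skew, skew_add_skew, mul_one, mul_zero] at H
  set k1 := (u 1 + t - u 4) * (v 2 + t + v 3) - (v 1 - v 4) * (u 2 + u 3) with hk1
  set k2 := (v 1 - v 4) * (w 2 + w 3) - (w 1 - w 4) * (v 2 + t + v 3) with hk2
  set k3 := (w 1 - w 4) * (u 2 + u 3) - (u 1 + t - u 4) * (w 2 + w 3) with hk3
  have hk1' : k1 ≠ 0 := by
    convert ht using 1
    rw [hk1]
    ring
  have H2 := H.combine_snd ![-(k1 * (w 0 + w 5) + k2 * (u 0 + u 5) + k3 * (v 0 + v 5)) / 2, k1,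
    k2, k3] hk1'
  simp only [smul_skew, skew_add_skew, mul_one, mul_zero, zero_add, Matrix.cons_val] at H2
  set a := -(k1 * (w 0 + w 5) + k2 * (u 0 + u 5) + k3 * (v 0 + v 5)) / 2 + k1 * w 0 + k2 * u 0 +
    k3 * v 0 with ha
  set b := k1 * w 1 + k2 * (u 1 + t) + k3 * v 1 with hb
  set c := k1 * w 2 + k2 * u 2 + k3 * (v 2 + t) with hc
  have H3 : HasBlocks γ (skew 1 0 0 0 0 1) (skew a b c (-c) b (-a))
      (skew (u 0) (u 1 + t) (u 2) (u 3) (u 4) (u 5))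
      (skew (v 0) (v 1) (v 2 + t) (v 3) (v 4) (v 5)) := by
    convert H2 using 2
    · simp only [hc, hk1, hk2, hk3]
      ring
    · simp only [hb, hk1, hk2, hk3]
      ring
    · rw [ha]
      ring
  obtain ⟨s, hs, H4⟩ := H3.perturb hγ 0 (skew 1 0 0 0 0 (-1)) 0 0
    (eventually_quadratic_ne_zero 0 1 a (by simp))
  simp only [smul_zero, add_zero, smul_skew, skew_add_skew, mul_one, mul_zero] at H4
  replace hs : a + s ≠ 0 := by
    convert hs using 1
    ring
  rcases hs.lt_or_gt with hs | hs
  · have H5 := H4.scale ![1, -1, 1, 1] (by intro i; fin_cases i <;> simp)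
    simp only [smul_skew, Matrix.cons_val, mul_zero, one_mul, mul_one] at H5
    refine ⟨-(a + s), -b, -c, ![u 0, u 1 + t, u 2, u 3, u 4, u 5],
      ![v 0, v 1, v 2 + t, v 3, v 4, v 5], by linarith, ?_⟩
    convert H5 using 2 <;> first | rfl | ring1
  · refine ⟨a + s, b, c, ![u 0, u 1 + t, u 2, u 3, u 4, u 5],
      ![v 0, v 1, v 2 + t, v 3, v 4, v 5], hs, ?_⟩
    convert H4 using 2 <;> first | rfl | ring1

lemma exists_hasBlocks_pencil (hγ : IsStableForm γ) :
    ∃ u v : Fin 6 → ℝ, HasBlocks γ (skew 1 0 0 0 0 1) (skew 1 0 0 0 0 (-1))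
      (skew (u 0) (u 1) (u 2) (u 3) (u 4) (u 5)) (skew (v 0) (v 1) (v 2) (v 3) (v 4) (v 5)) := by
  obtain ⟨a, b, c, u, v, ha, H⟩ := exists_hasBlocks_traceless hγ
  set n := √(a ^ 2 + b ^ 2 + c ^ 2) with hn
  have hn2 : n ^ 2 = a ^ 2 + b ^ 2 + c ^ 2 := Real.sq_sqrt (by positivity)
  have hn0 : 0 < n := Real.sqrt_pos.2 (by positivity)
  set h : Matrix (Fin 4) (Fin 4) ℝ :=
    !![n + a, 0, -c, b; 0, n + a, -b, -c; c, b, n + a, 0; -b, c, 0, n + a] with hh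
  obtain ⟨u', hu'⟩ := exists_skew_eq_conj h (u 0) (u 1) (u 2) (u 3) (u 4) (u 5)
  obtain ⟨v', hv'⟩ := exists_skew_eq_conj h (v 0) (v 1) (v 2) (v 3) (v 4) (v 5)
  have hdet : h.det = (2 * n * (n + a)) ^ 2 := by
    have : h.det = ((n + a) ^ 2 + b ^ 2 + c ^ 2) ^ 2 := by
      simp [hh, Matrix.det_succ_row_zero, Fin.sum_univ_succ, Fin.succAbove]
      ring
    rw [this]
    congr 1
    linear_combination -hn2
  set l := 2 * n * (n + a) with hl
  have hl0 : l ≠ 0 := by positivity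
  have H2 := H.conj_of h (A' := skew l 0 0 0 0 l) (B' := skew (n * l) 0 0 0 0 (-(n * l)))
    (by rw [hdet]; positivity) (by
      rw [transpose_mul_skew_mul]
      congr 1 <;> simp [hh, hl] <;> first | ring1 | linear_combination -hn2) (by
      rw [transpose_mul_skew_mul]
      congr 1 <;> simp [hh, hl] <;> first
        | ring1
        | linear_combination (2 * n + a) * hn2
        | linear_combination -(2 * n + a) * hn2
        | linear_combination b * hn2
        | linear_combination c * hn2
        | linear_combination -b * hn2
        | linear_combination -c * hn2) hu' hv'
  have H3 := H2.scale ![1 / l, 1 / (n * l), 1, 1] (by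
    intro i
    fin_cases i <;> simp [hl0, hn0.ne'])
  refine ⟨u', v', ?_⟩
  convert H3 using 1
  · rw [smul_skew]
    congr 1 <;> simp [hl0]
  · rw [smul_skew]
    congr 1 <;> simp <;> field_simp
  · simp
  · simp

lemma exists_hasBlocks_offDiag (hγ : IsStableForm γ) :
    ∃ (b c d e : ℝ) (v : Fin 4 → ℝ), b * e - c * d ≠ 0 ∧
      HasBlocks γ (skew 1 0 0 0 0 1) (skew 1 0 0 0 0 (-1)) (skew 0 b c d e 0)
        (skew 0 (v 0) (v 1) (v 2) (v 3) 0) := by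
  obtain ⟨u, v, H⟩ := exists_hasBlocks_pencil hγ
  have H2 := H.shear 0 (-(u 0 + u 5) / 2) (-(u 0 - u 5) / 2) (-(v 0 + v 5) / 2)
    (-(v 0 - v 5) / 2) 0
  obtain ⟨t, ht, H3⟩ := H2.perturb hγ 0 0 (skew 0 1 0 0 1 0) 0
    (eventually_quadratic_ne_zero 1 (u 1 + u 4) (u 1 * u 4 - u 2 * u 3) (by simp))
  simp only [smul_zero, zero_smul, add_zero, smul_skew, skew_add_skew, mul_one, mul_zero] at H3
  refine ⟨u 1 + t, u 2, u 3, u 4 + t, ![v 1, v 2, v 3, v 4], ?_, ?_⟩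
  · convert ht using 1
    ring
  · convert H3 using 2 <;> first | rfl | ring1

lemma exists_sign (x : ℝ) (hx : x ≠ 0) : ∃ s y : ℝ, (s = 1 ∨ s = -1) ∧ 0 < y ∧ x = s * y ^ 2 := by
  rcases hx.lt_or_gt with h | h
  · exact ⟨-1, √(-x), Or.inr rfl, Real.sqrt_pos.2 (by linarith), by
      rw [Real.sq_sqrt (by linarith)]
      ring⟩
  · exact ⟨1, √x, Or.inl rfl, Real.sqrt_pos.2 h, by
      rw [Real.sq_sqrt h.le]
      ring⟩

lemma exists_hasBlocks_third (hγ : IsStableForm γ) :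
    ∃ s p q r : ℝ, (s = 1 ∨ s = -1) ∧ r ≠ 0 ∧ p ^ 2 + q * r ≠ 0 ∧
      HasBlocks γ (skew 1 0 0 0 0 1) (skew 1 0 0 0 0 (-1)) (skew 0 1 0 0 s 0)
        (skew 0 p q (s * r) (-(s * p)) 0) := by
  obtain ⟨b, c, d, e, v, hδ, H⟩ := exists_hasBlocks_offDiag hγ
  obtain ⟨s, y, hs, hy, hδy⟩ := exists_sign _ hδ
  have hs2 : s * s = 1 := by rcases hs with rfl | rfl <;> norm_num
  have hs0 : s ≠ 0 := by rcases hs with rfl | rfl <;> norm_num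
  set h : Matrix (Fin 4) (Fin 4) ℝ :=
    !![y, 0, 0, 0; 0, y, 0, 0; 0, 0, e, -(c * s); 0, 0, -d, b * s] with hh
  obtain ⟨w, hw⟩ := exists_skew_eq_conj h 0 (v 0) (v 1) (v 2) (v 3) 0
  have hdet : h.det ≠ 0 := by
    have : h.det = s ^ 2 * y ^ 4 := by
      simp [hh, Matrix.det_succ_row_zero, Fin.sum_univ_succ, Fin.succAbove]
      linear_combination s * y ^ 2 * hδy
    rw [this]
    positivity
  have H2 := H.conj_of h (A' := skew (y ^ 2) 0 0 0 0 (y ^ 2))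
    (B' := skew (y ^ 2) 0 0 0 0 (-y ^ 2))
    (C' := skew 0 (s * y ^ 3) 0 0 (s * (s * y ^ 3)) 0) hdet
    (by
      rw [transpose_mul_skew_mul]
      congr 1 <;> simp [hh] <;> first
        | ring1
        | linear_combination s * hδy + y ^ 2 * hs2) (by
      rw [transpose_mul_skew_mul]
      congr 1 <;> simp [hh] <;> first
        | ring1
        | linear_combination -s * hδy - y ^ 2 * hs2)
    (by
      rw [transpose_mul_skew_mul]
      congr 1 <;> simp [hh] <;> first
        | ring1
        | linear_combination y * hδy
        | linear_combination s * y * hδy) hw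
  have H3 : HasBlocks γ (skew 1 0 0 0 0 1) (skew 1 0 0 0 0 (-1)) (skew 0 1 0 0 s 0)
      (skew (w 0) (w 1) (w 2) (w 3) (w 4) (w 5)) := by
    convert H2.scale ![1 / y ^ 2, 1 / y ^ 2, 1 / (s * y ^ 3), 1] (by
      intro i
      fin_cases i <;> simp [hs0, hy.ne']) using 1
    all_goals
      simp only [smul_skew, Matrix.cons_val]
      congr 1 <;> field_simp <;> ring
  have H4 := H3.shear 0 0 0 (-(w 0 + w 5) / 2) (-(w 0 - w 5) / 2) (-(w 1 + s * w 4) / 2)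
  set p := (w 1 - s * w 4) / 2 with hp
  obtain ⟨t, ⟨hr, hΔ⟩, H5⟩ := H4.perturb hγ 0 0 0 (skew 0 1 0 s (-s) 0)
    ((eventually_quadratic_ne_zero 0 1 (s * w 3) (by simp)).and
    (eventually_quadratic_ne_zero 1 (2 * p + w 2) (p ^ 2 + w 2 * (s * w 3)) (by simp)))
  refine ⟨s, p + t, w 2, s * w 3 + t, hs, ?_, ?_, ?_⟩
  · convert hr using 1
    ring
  · convert hΔ using 1
    ring
  · convert H5 using 1
    · simp
    · simp
    · simp
    · simp only [smul_skew, skew_add_skew]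
      congr 1 <;> (try simp only [hp]) <;> first
        | ring1
        | linear_combination (w 3) * hs2
        | linear_combination -(w 3) * hs2
        | linear_combination (w 4) * hs2

/-- Every stable form is equivalent to a block form whose blocks depend on two signs only. -/
lemma exists_hasBlocks_signs (hγ : IsStableForm γ) :
    ∃ s r : ℝ, (s = 1 ∨ s = -1) ∧ (r = 1 ∨ r = -1) ∧
      HasBlocks γ (skew 1 0 0 0 0 1) (skew 1 0 0 0 0 (-1)) (skew 0 1 0 0 s 0)
        (skew 0 0 (-r) s 0 0) := by
  obtain ⟨s, p, q, r, hs, hr, hΔ, H⟩ := exists_hasBlocks_third hγ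
  obtain ⟨ε, y, hε, hy, hΔy⟩ := exists_sign (-(p ^ 2 + q * r)) (neg_ne_zero.2 hΔ)
  have hs2 : s * s = 1 := by rcases hs with rfl | rfl <;> norm_num
  set h : Matrix (Fin 4) (Fin 4) ℝ :=
    !![r, 0, 0, 0; -(s * p), y, 0, 0; 0, 0, y, p; 0, 0, 0, r] with hh
  have hdet : h.det ≠ 0 := by
    have : h.det = (y * r) ^ 2 := by
      simp [hh, Matrix.det_succ_row_zero, Fin.sum_univ_succ, Fin.succAbove]
      ring
    rw [this]
    exact pow_ne_zero _ (mul_ne_zero hy.ne' hr)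
  have H2 := H.conj_of h (A' := skew (y * r) 0 0 0 0 (y * r))
    (B' := skew (y * r) 0 0 0 0 (-(y * r))) (C' := skew 0 (y * r) 0 0 (s * (y * r)) 0)
    (D' := skew 0 0 (-(ε * (y ^ 2 * r))) (s * (y ^ 2 * r)) 0 0) hdet
    (by
      rw [transpose_mul_skew_mul]
      congr 1 <;> simp [hh]
      all_goals ring)
    (by
      rw [transpose_mul_skew_mul]
      congr 1 <;> simp [hh]
      all_goals ring)
    (by
      rw [transpose_mul_skew_mul]
      congr 1 <;> simp [hh] <;> first
        | ring1
        | linear_combination p * r * hs2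
        | linear_combination -p * r * hs2)
    (by
      rw [transpose_mul_skew_mul]
      congr 1 <;> simp [hh] <;> first
        | ring1
        | linear_combination p * r * y * hs2
        | linear_combination -p * r * y * hs2
        | linear_combination r * hΔy
        | linear_combination -r * hΔy)
  have H3 := H2.scale ![1 / (y * r), 1 / (y * r), 1 / (y * r), 1 / (y ^ 2 * r)] (by
    intro i
    fin_cases i <;> simp [hr, hy.ne'])
  refine ⟨s, ε, hs, hε, ?_⟩
  convert H3 using 1
  all_goals
    simp only [smul_skew, Matrix.cons_val]
    congr 1 <;> field_simp <;> ring

lemma blockForm_mem_orbit_of_mul_pos {c c' : ℝ} {W : Fin 4 → Matrix (Fin 4) (Fin 4) ℝ}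
    (h : blockForm c W ∈ orbit γ) (hc : 0 < c * c') : blockForm c' W ∈ orbit γ := by
  have hc0 : c' ≠ 0 := right_ne_zero_of_mul hc.ne'
  have hpos : 0 < c / c' := by
    have : c / c' = c * c' / c' ^ 2 := by field_simp
    rw [this]
    positivity
  set s := (c / c') ^ (((6 : ℕ) : ℝ)⁻¹) with hs
  have hs0 : 0 < s := Real.rpow_pos_of_pos hpos _
  have hs6 : s ^ 6 = c / c' := Real.rpow_inv_natCast_pow hpos.le (by norm_num)
  have := blockForm_mem_orbit h ((s ^ 2)⁻¹ • 1) (s • 1) (fun i => by simp)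
    (by simp [hs0.ne']) (by simp [hs0.ne'])
  convert this using 2
  · have : (((s ^ 2)⁻¹ • (1 : Matrix (Fin 4) (Fin 4) ℝ)).submatrix Fin.succ Fin.succ) =
        (s ^ 2)⁻¹ • (1 : Matrix (Fin 3) (Fin 3) ℝ) := by
      rw [Matrix.submatrix_smul]
      simp [Matrix.submatrix_one _ (Fin.succ_injective _)]
    rw [this, Matrix.det_smul, Matrix.det_one, mul_one, Fintype.card_fin, inv_pow, ← pow_mul, hs6,
      inv_div, mul_div_cancel₀ _ (left_ne_zero_of_mul hc.ne')]
  · ext j : 1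
    simp [Matrix.one_apply, smul_smul]
    field_simp
    simp

/-- The linear map with prescribed halves. -/
def halvesMap (Y Z : Matrix (Fin 4) (Fin 8) ℝ) : (Fin 8 → ℝ) →ₗ[ℝ] (Fin 8 → ℝ) where
  toFun x := join (Y.mulVec x) (Z.mulVec x)
  map_add' x y := halves_ext (by simp [Matrix.mulVec_add]) (by simp [Matrix.mulVec_add])
  map_smul' r x := halves_ext (by simp [Matrix.mulVec_smul]) (by simp [Matrix.mulVec_smul])

@[simp] lemma head_halvesMap (Y Z : Matrix (Fin 4) (Fin 8) ℝ) (x : Fin 8 → ℝ) :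
    head (halvesMap Y Z x) = Y.mulVec x := head_join _ _

@[simp] lemma tail_halvesMap (Y Z : Matrix (Fin 4) (Fin 8) ℝ) (x : Fin 8 → ℝ) :
    tail (halvesMap Y Z x) = Z.mulVec x := tail_join _ _

lemma mem_orbit_of_blockForm {c : ℝ} {W : Fin 4 → Matrix (Fin 4) (Fin 4) ℝ} {φ : ThreeForm}
    (h : blockForm c W ∈ orbit γ) (Y Z : Matrix (Fin 4) (Fin 8) ℝ)
    (hinj : ∀ x, Y.mulVec x = 0 → Z.mulVec x = 0 → x = 0)
    (hφ : ∀ x y z, c * volThree (Y.mulVec x) (Y.mulVec y) (Y.mulVec z) +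
      ∑ a, (Y.mulVec x a * skewPairing (W a) (Z.mulVec y) (Z.mulVec z)
        - Y.mulVec y a * skewPairing (W a) (Z.mulVec x) (Z.mulVec z)
        + Y.mulVec z a * skewPairing (W a) (Z.mulVec x) (Z.mulVec y)) = φ ![x, y, z]) :
    φ ∈ orbit γ := by
  have : φ = formPullback (halvesMap Y Z) (blockForm c W) := ext_apply fun x y z => by
    simp only [formPullback_apply, blockForm_apply, head_halvesMap, tail_halvesMap, hφ]
  rw [this]
  refine pullback_mem_orbit h _ fun x hx => hinj x ?_ ?_
  · rw [← head_halvesMap Y Z, hx, map_zero]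
  · rw [← tail_halvesMap Y Z, hx, map_zero]

lemma phiOne_mem_orbit {s σ : ℝ} (hs : s = 1 ∨ s = -1) (hσ : σ = 1 ∨ σ = -1)
    (h : blockForm (σ / 2) ![skew 1 0 0 0 0 1, skew 1 0 0 0 0 (-1), skew 0 1 0 0 s 0,
      skew 0 0 1 s 0 0] ∈ orbit γ) : phiOne ∈ orbit γ := by
  have hs2 : s ^ 2 = 1 := by rcases hs with rfl | rfl <;> norm_num
  have hσ2 : σ ^ 2 = 1 := by rcases hσ with rfl | rfl <;> norm_num
  refine mem_orbit_of_blockForm h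
    !![0, -s * σ, s * σ, 0, 0, 0, 0, 0; 0, -s * σ, -s * σ, 0, 0, 0, 0, 0;
      1, 0, 0, -s, 0, 0, 0, 0; 1, 0, 0, s, 0, 0, 0, 0]
    !![0, 0, 0, 0, 1 / 2, σ / 2, 0, 0; 0, 0, 0, 0, s / 2, -s * σ / 2, 0, 0;
      0, 0, 0, 0, 0, 0, 1 / 2, -s * σ / 2; 0, 0, 0, 0, 0, 0, 1 / 2, s * σ / 2]
    (fun x hY hZ => ?_) (fun x y z => ?_)
  · simp only [funext_iff, Fin.forall_fin_succ, Matrix.mulVec, dotProduct,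
      Fin.sum_univ_eight] at hY hZ
    simp at hY hZ
    ext i
    rcases hs with rfl | rfl <;> rcases hσ with rfl | rfl <;> fin_cases i <;> simp <;> linarith
  · simp only [Fin.sum_univ_four, Matrix.cons_val, skewPairing_skew, volThree, Matrix.mulVec,
      dotProduct, Fin.sum_univ_eight, phiOne, AlternatingMap.add_apply, eee_apply]
    simp
    rcases hs with rfl | rfl <;> rcases hσ with rfl | rfl <;> ring

lemma phiThree_mem_orbit (h : blockForm 2 ![skew 1 0 0 0 0 1, skew 1 0 0 0 0 (-1),
    skew 0 1 0 0 1 0, skew 0 0 (-1) 1 0 0] ∈ orbit γ) : phiThree ∈ orbit γ := by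
  refine mem_orbit_of_blockForm h
    !![0, 0, 0, 0, 0, 0, 1 / 2, -1 / 2; 0, 0, 0, 0, 0, 0, 1 / 2, 1 / 2;
      1, 0, 0, 0, 0, 0, 0, 0; 0, 1, 0, 0, 0, 0, 0, 0]
    !![0, 0, 1, 0, 0, 0, 0, 0; 0, 0, 0, 1, 0, 0, 0, 0;
      0, 0, 0, 0, 1, 0, 0, 0; 0, 0, 0, 0, 0, -1, 0, 0]
    (fun x hY hZ => ?_) (fun x y z => ?_)
  · simp only [funext_iff, Fin.forall_fin_succ, Matrix.mulVec, dotProduct,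
      Fin.sum_univ_eight] at hY hZ
    simp at hY hZ
    ext i
    fin_cases i <;> simp <;> linarith
  · simp only [Fin.sum_univ_four, Matrix.cons_val, skewPairing_skew, volThree, Matrix.mulVec,
      dotProduct, Fin.sum_univ_eight, phiThree, AlternatingMap.add_apply, AlternatingMap.sub_apply,
      eee_apply]
    simp
    ring

lemma phiTwo_mem_orbit_of_pos (h : blockForm 16 ![skew 1 0 0 0 0 1, skew 1 0 0 0 0 (-1),
    skew 0 1 0 0 (-1) 0, skew 0 0 (-1) (-1) 0 0] ∈ orbit γ) : phiTwo ∈ orbit γ := by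
  refine mem_orbit_of_blockForm h
    !![0, 0, 0, 0, 1 / 2, 0, 0, 0; 0, 0, 0, 0, 0, 0, 1 / 4, 1 / 4;
      0, 0, 0, 0, 0, 1 / 2, 0, 0; 0, 0, 0, 0, 0, 0, 1 / 4, -1 / 4]
    !![1, 0, 0, -1, 0, 0, 0, 0; 0, 1, 1, 0, 0, 0, 0, 0;
      1, 0, 0, 1, 0, 0, 0, 0; 0, -1, 1, 0, 0, 0, 0, 0]
    (fun x hY hZ => ?_) (fun x y z => ?_)
  · simp only [funext_iff, Fin.forall_fin_succ, Matrix.mulVec, dotProduct,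
      Fin.sum_univ_eight] at hY hZ
    simp at hY hZ
    ext i
    fin_cases i <;> simp <;> linarith
  · simp only [Fin.sum_univ_four, Matrix.cons_val, skewPairing_skew, volThree, Matrix.mulVec,
      dotProduct, Fin.sum_univ_eight, phiTwo, AlternatingMap.add_apply, AlternatingMap.sub_apply,
      eee_apply]
    simp
    ring

lemma phiTwo_mem_orbit_of_neg (h : blockForm (-16) ![skew 1 0 0 0 0 1, skew 1 0 0 0 0 (-1),
    skew 0 1 0 0 (-1) 0, skew 0 0 (-1) (-1) 0 0] ∈ orbit γ) : phiTwo ∈ orbit γ := by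
  refine mem_orbit_of_blockForm h
    !![0, 0, 0, 0, 1 / 2, 0, 0, 0; 0, 0, 0, 0, 0, 0, -1 / 4, -1 / 4;
      0, 0, 0, 0, 0, -1 / 2, 0, 0; 0, 0, 0, 0, 0, 0, -1 / 4, 1 / 4]
    !![1, 0, 0, 1, 0, 0, 0, 0; 0, -1, 1, 0, 0, 0, 0, 0;
      1, 0, 0, -1, 0, 0, 0, 0; 0, 1, 1, 0, 0, 0, 0, 0]
    (fun x hY hZ => ?_) (fun x y z => ?_)
  · simp only [funext_iff, Fin.forall_fin_succ, Matrix.mulVec, dotProduct,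
      Fin.sum_univ_eight] at hY hZ
    simp at hY hZ
    ext i
    fin_cases i <;> simp <;> linarith
  · simp only [Fin.sum_univ_four, Matrix.cons_val, skewPairing_skew, volThree, Matrix.mulVec,
      dotProduct, Fin.sum_univ_eight, phiTwo, AlternatingMap.add_apply, AlternatingMap.sub_apply,
      eee_apply]
    simp
    ring

lemma phiTwo_mem_orbit_of_sign_pos (h : blockForm (-16) ![skew 1 0 0 0 0 1,
    skew 1 0 0 0 0 (-1), skew 0 1 0 0 1 0, skew 0 0 (-1) 1 0 0] ∈ orbit γ) :
    phiTwo ∈ orbit γ := by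
  refine mem_orbit_of_blockForm h
    !![0, 0, 0, 0, 1 / 4, 0, -3 / 8, -3 / 8; 0, 0, 0, 0, -1 / 4, 0, -1 / 8, -1 / 8;
      1 / 4, -1 / 4, -1 / 4, -1 / 4, 0, 0, 0, 0; 1 / 4, 1 / 4, 1 / 4, -1 / 4, 0, 0, 0, 0]
    !![0, 0, 0, 0, 0, 1, 1 / 2, -1 / 2; 0, 0, 0, 0, 0, 1, -1 / 2, 1 / 2;
      -1, 0, 0, -1, 0, 0, 0, 0; 0, 1, -1, 0, 0, 0, 0, 0]
    (fun x hY hZ => ?_) (fun x y z => ?_)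
  · simp only [funext_iff, Fin.forall_fin_succ, Matrix.mulVec, dotProduct,
      Fin.sum_univ_eight] at hY hZ
    simp at hY hZ
    ext i
    fin_cases i <;> simp <;> linarith
  · simp only [Fin.sum_univ_four, Matrix.cons_val, skewPairing_skew, volThree, Matrix.mulVec,
      dotProduct, Fin.sum_univ_eight, phiTwo, AlternatingMap.add_apply, AlternatingMap.sub_apply,
      eee_apply]
    simp
    ring

/-- Every stable orbit contains one of the three model forms. -/
lemma exists_model_mem_orbit (hγ : IsStableForm γ) :
    phiOne ∈ orbit γ ∨ phiTwo ∈ orbit γ ∨ phiThree ∈ orbit γ := by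
  obtain ⟨s, r, hs, hr, c, hc, H⟩ := exists_hasBlocks_signs hγ
  rcases hr with rfl | rfl
  · refine Or.inr ?_
    rcases hs with rfl | rfl <;> rcases hc.lt_or_gt with hc | hc
    · exact Or.inl (phiTwo_mem_orbit_of_sign_pos
        (blockForm_mem_orbit_of_mul_pos H (by linarith)))
    · exact Or.inr (phiThree_mem_orbit (blockForm_mem_orbit_of_mul_pos H (by linarith)))
    · exact Or.inl (phiTwo_mem_orbit_of_neg (blockForm_mem_orbit_of_mul_pos H (by linarith)))
    · exact Or.inl (phiTwo_mem_orbit_of_pos (blockForm_mem_orbit_of_mul_pos H (by linarith)))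
  · rw [neg_neg] at H
    rcases hc.lt_or_gt with hc | hc
    · exact Or.inl (phiOne_mem_orbit hs (Or.inr rfl)
        (blockForm_mem_orbit_of_mul_pos H (by linarith)))
    · exact Or.inl (phiOne_mem_orbit hs (Or.inl rfl)
        (blockForm_mem_orbit_of_mul_pos H (by linarith)))

/-- `A` is an infinitesimal symmetry of `φ`: it lies in the Lie algebra of the stabiliser of `φ`
in the general linear group. -/
def IsSymmetry (φ : ThreeForm) (A : Matrix (Fin 8) (Fin 8) ℝ) : Prop :=
  ∀ x y z, φ ![A.mulVec x, y, z] + φ ![x, A.mulVec y, z] + φ ![x, y, A.mulVec z] = 0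

lemma IsSymmetry.trace_sq_of_phiThree {A : Matrix (Fin 8) (Fin 8) ℝ}
    (hA : IsSymmetry phiThree A) :
    (A * A).trace = -2 * (A 3 2 ^ 2 + A 5 4 ^ 2 + (A 3 2 + A 5 4) ^ 2)
      - 3 * (A 7 0 ^ 2 + A 7 1 ^ 2 + A 7 2 ^ 2 + A 7 3 ^ 2)
      - 3 / 4 * (A 7 4 ^ 2 + A 7 5 ^ 2) := by
  have h012 := hA (e 0) (e 1) (e 2)
  have h013 := hA (e 0) (e 1) (e 3)
  have h014 := hA (e 0) (e 1) (e 4)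
  have h015 := hA (e 0) (e 1) (e 5)
  have h016 := hA (e 0) (e 1) (e 6)
  have h017 := hA (e 0) (e 1) (e 7)
  have h023 := hA (e 0) (e 2) (e 3)
  have h024 := hA (e 0) (e 2) (e 4)
  have h025 := hA (e 0) (e 2) (e 5)
  have h026 := hA (e 0) (e 2) (e 6)
  have h027 := hA (e 0) (e 2) (e 7)
  have h034 := hA (e 0) (e 3) (e 4)
  have h035 := hA (e 0) (e 3) (e 5)
  have h036 := hA (e 0) (e 3) (e 6)
  have h037 := hA (e 0) (e 3) (e 7)
  have h045 := hA (e 0) (e 4) (e 5)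
  have h046 := hA (e 0) (e 4) (e 6)
  have h047 := hA (e 0) (e 4) (e 7)
  have h056 := hA (e 0) (e 5) (e 6)
  have h057 := hA (e 0) (e 5) (e 7)
  have h067 := hA (e 0) (e 6) (e 7)
  have h123 := hA (e 1) (e 2) (e 3)
  have h124 := hA (e 1) (e 2) (e 4)
  have h125 := hA (e 1) (e 2) (e 5)
  have h126 := hA (e 1) (e 2) (e 6)
  have h127 := hA (e 1) (e 2) (e 7)
  have h134 := hA (e 1) (e 3) (e 4)
  have h135 := hA (e 1) (e 3) (e 5)
  have h136 := hA (e 1) (e 3) (e 6)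
  have h137 := hA (e 1) (e 3) (e 7)
  have h145 := hA (e 1) (e 4) (e 5)
  have h146 := hA (e 1) (e 4) (e 6)
  have h147 := hA (e 1) (e 4) (e 7)
  have h156 := hA (e 1) (e 5) (e 6)
  have h157 := hA (e 1) (e 5) (e 7)
  have h167 := hA (e 1) (e 6) (e 7)
  have h234 := hA (e 2) (e 3) (e 4)
  have h235 := hA (e 2) (e 3) (e 5)
  have h236 := hA (e 2) (e 3) (e 6)
  have h237 := hA (e 2) (e 3) (e 7)
  have h245 := hA (e 2) (e 4) (e 5)
  have h246 := hA (e 2) (e 4) (e 6)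
  have h247 := hA (e 2) (e 4) (e 7)
  have h256 := hA (e 2) (e 5) (e 6)
  have h257 := hA (e 2) (e 5) (e 7)
  have h267 := hA (e 2) (e 6) (e 7)
  have h345 := hA (e 3) (e 4) (e 5)
  have h346 := hA (e 3) (e 4) (e 6)
  have h347 := hA (e 3) (e 4) (e 7)
  have h356 := hA (e 3) (e 5) (e 6)
  have h357 := hA (e 3) (e 5) (e 7)
  have h367 := hA (e 3) (e 6) (e 7)
  have h456 := hA (e 4) (e 5) (e 6)
  have h457 := hA (e 4) (e 5) (e 7)
  have h467 := hA (e 4) (e 6) (e 7)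
  have h567 := hA (e 5) (e 6) (e 7)
  simp [phiThree, eee_apply, -neg_eq_zero] at h012 h013 h014 h015 h016 h017 h023 h024 h025 h026
  simp [phiThree, eee_apply, -neg_eq_zero] at h027 h034 h035 h036 h037 h045 h046 h047 h056 h057
  simp [phiThree, eee_apply, -neg_eq_zero] at h067 h123 h124 h125 h126 h127 h134 h135 h136 h137
  simp [phiThree, eee_apply, -neg_eq_zero] at h145 h146 h147 h156 h157 h167 h234 h235 h236 h237
  simp [phiThree, eee_apply, -neg_eq_zero] at h245 h246 h247 h256 h257 h267 h345 h346 h347 h356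
  simp [phiThree, eee_apply, -neg_eq_zero] at h357 h367 h456 h457 h467 h567
  have a00 : A 0 0 = 0 := by
    linear_combination 1 / 6 * h016 + 1 / 6 * h017 + 1 / 3 * h024 - 1 / 3 * h035 - 1 / 6 * h125
      - 1 / 6 * h134 - 1 / 6 * h236 - 1 / 6 * h237 - 1 / 6 * h456 - 1 / 6 * h457
  have a01 : A 0 1 = -A 3 2 - A 5 4 := by
    linear_combination h124
  have a02 : A 0 2 = -1 / 4 * A 7 5 := by
    linear_combination 1 / 4 * h015 + 1 / 4 * h036 - 1 / 2 * h037 - 1 / 4 * h126 - 1 / 2 * h127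
      - 1 / 4 * h235 + 1 / 2 * h467
  have a03 : A 0 3 = -1 / 4 * A 7 4 := by
    linear_combination 1 / 4 * h014 - 1 / 4 * h026 + 1 / 2 * h027 - 1 / 4 * h136 - 1 / 2 * h137
      - 1 / 4 * h234 - 1 / 2 * h567
  have a04 : A 0 4 = -1 / 2 * A 7 3 := by
    linear_combination -1 / 2 * h056 - 1 / 2 * h146 + 1 / 2 * h345
  have a05 : A 0 5 = -1 / 2 * A 7 2 := by
    linear_combination 1 / 2 * h046 - 1 / 2 * h156 + 1 / 2 * h245
  have a06 : A 0 6 = -1 / 2 * A 7 0 := by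
    linear_combination 1 / 2 * h045 + 1 / 2 * h246 - 1 / 2 * h356
  have a07 : A 0 7 = -1 / 2 * A 7 0 := by
    linear_combination 1 / 2 * h045 + h167 + 1 / 2 * h246 - 1 / 2 * h356
  have a10 : A 1 0 = A 3 2 + A 5 4 := by
    linear_combination 1 / 2 * h025 + 1 / 2 * h034 - 1 / 2 * h124 - 1 / 2 * h135
  have a11 : A 1 1 = 0 := by
    linear_combination 1 / 6 * h016 + 1 / 6 * h017 - 1 / 6 * h024 + 1 / 6 * h035 + 1 / 3 * h125
      + 1 / 3 * h134 - 1 / 6 * h236 - 1 / 6 * h237 - 1 / 6 * h456 - 1 / 6 * h457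
  have a12 : A 1 2 = 1 / 4 * A 7 4 := by
    linear_combination -1 / 4 * h014 + 1 / 4 * h026 + 1 / 2 * h027 + 1 / 4 * h136 - 1 / 2 * h137
      + 1 / 4 * h234 + 1 / 2 * h567
  have a13 : A 1 3 = -1 / 4 * A 7 5 := by
    linear_combination 1 / 4 * h015 + 1 / 4 * h036 + 1 / 2 * h037 - 1 / 4 * h126 + 1 / 2 * h127
      - 1 / 4 * h235 + 1 / 2 * h467
  have a14 : A 1 4 = 1 / 2 * A 7 2 := by
    linear_combination 1 / 2 * h046 - 1 / 2 * h156 - 1 / 2 * h245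
  have a15 : A 1 5 = -1 / 2 * A 7 3 := by
    linear_combination 1 / 2 * h056 + 1 / 2 * h146 + 1 / 2 * h345
  have a16 : A 1 6 = -1 / 2 * A 7 1 := by
    linear_combination 1 / 2 * h145 + 1 / 2 * h256 + 1 / 2 * h346
  have a17 : A 1 7 = -1 / 2 * A 7 1 := by
    linear_combination -h067 + 1 / 2 * h145 + 1 / 2 * h256 + 1 / 2 * h346
  have a20 : A 2 0 = 1 / 4 * A 7 5 := by
    linear_combination -1 / 4 * h015 + 3 / 4 * h036 - 1 / 2 * h037 + 1 / 4 * h126 - 1 / 2 * h127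
      + 1 / 4 * h235 + 1 / 2 * h467
  have a21 : A 2 1 = -1 / 4 * A 7 4 := by
    linear_combination 1 / 4 * h014 - 1 / 4 * h026 + 1 / 2 * h027 + 3 / 4 * h136 - 1 / 2 * h137
      - 1 / 4 * h234 + 1 / 2 * h567
  have a22 : A 2 2 = 0 := by
    linear_combination -1 / 3 * h016 + 1 / 6 * h017 + 1 / 3 * h024 + 1 / 6 * h035 + 1 / 3 * h125
      - 1 / 6 * h134 + 1 / 3 * h236 - 1 / 6 * h237 + 1 / 3 * h456 - 1 / 6 * h457
  have a23 : A 2 3 = -A 3 2 := by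
    linear_combination -1 / 2 * h025 + 1 / 2 * h034 + 1 / 2 * h124 + 1 / 2 * h135
  have a24 : A 2 4 = -1 / 2 * A 7 1 := by
    linear_combination 1 / 2 * h145 + 1 / 2 * h256 - 1 / 2 * h346
  have a25 : A 2 5 = 1 / 2 * A 7 0 := by
    linear_combination -1 / 2 * h045 - 1 / 2 * h246 - 1 / 2 * h356
  have a26 : A 2 6 = 1 / 2 * A 7 2 := by
    linear_combination -1 / 2 * h046 - 1 / 2 * h156 - 1 / 2 * h245
  have a27 : A 2 7 = 0 := by
    linear_combination h367
  have a30 : A 3 0 = 1 / 4 * A 7 4 := by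
    linear_combination -1 / 4 * h014 - 3 / 4 * h026 + 1 / 2 * h027 + 1 / 4 * h136 - 1 / 2 * h137
      + 1 / 4 * h234 - 1 / 2 * h567
  have a31 : A 3 1 = 1 / 4 * A 7 5 := by
    linear_combination -1 / 4 * h015 - 1 / 4 * h036 + 1 / 2 * h037 - 3 / 4 * h126 + 1 / 2 * h127
      + 1 / 4 * h235 + 1 / 2 * h467
  have a33 : A 3 3 = 0 := by
    linear_combination -1 / 3 * h016 + 1 / 6 * h017 - 1 / 6 * h024 - 1 / 3 * h035 - 1 / 6 * h125
      + 1 / 3 * h134 + 1 / 3 * h236 - 1 / 6 * h237 + 1 / 3 * h456 - 1 / 6 * h457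
  have a34 : A 3 4 = 1 / 2 * A 7 0 := by
    linear_combination -1 / 2 * h045 + 1 / 2 * h246 + 1 / 2 * h356
  have a35 : A 3 5 = 1 / 2 * A 7 1 := by
    linear_combination -1 / 2 * h145 + 1 / 2 * h256 - 1 / 2 * h346
  have a36 : A 3 6 = 1 / 2 * A 7 3 := by
    linear_combination 1 / 2 * h056 - 1 / 2 * h146 - 1 / 2 * h345
  have a37 : A 3 7 = 0 := by
    linear_combination -h267
  have a40 : A 4 0 = 1 / 2 * A 7 3 := by
    linear_combination -1 / 2 * h056 + h057 - 1 / 2 * h146 + h267 - 1 / 2 * h345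
  have a41 : A 4 1 = -1 / 2 * A 7 2 := by
    linear_combination 1 / 2 * h046 - 1 / 2 * h156 + h157 + 1 / 2 * h245 + h367
  have a42 : A 4 2 = 1 / 2 * A 7 1 := by
    linear_combination h067 - 1 / 2 * h145 - 1 / 2 * h256 + h257 - 1 / 2 * h346
  have a43 : A 4 3 = -1 / 2 * A 7 0 := by
    linear_combination 1 / 2 * h045 + h167 + 1 / 2 * h246 - 1 / 2 * h356 + h357
  have a44 : A 4 4 = 0 := by
    linear_combination 1 / 6 * h016 - 1 / 3 * h017 + 1 / 3 * h024 + 1 / 6 * h035 - 1 / 6 * h125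
      + 1 / 3 * h134 - 1 / 6 * h236 + 1 / 3 * h237 - 1 / 6 * h456 + 1 / 3 * h457
  have a45 : A 4 5 = -A 5 4 := by
    linear_combination 1 / 2 * h025 - 1 / 2 * h034 + 1 / 2 * h124 + 1 / 2 * h135
  have a46 : A 4 6 = 0 := by
    linear_combination -h567
  have a47 : A 4 7 = -1 / 4 * A 7 4 := by
    linear_combination 1 / 4 * h014 - 1 / 4 * h026 + 1 / 2 * h027 - 1 / 4 * h136 + 1 / 2 * h137
      - 1 / 4 * h234 - 1 / 2 * h567
  have a50 : A 5 0 = 1 / 2 * A 7 2 := by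
    linear_combination 1 / 2 * h046 - h047 - 1 / 2 * h156 - 1 / 2 * h245 - h367
  have a51 : A 5 1 = 1 / 2 * A 7 3 := by
    linear_combination 1 / 2 * h056 + 1 / 2 * h146 - h147 + h267 - 1 / 2 * h345
  have a52 : A 5 2 = -1 / 2 * A 7 0 := by
    linear_combination 1 / 2 * h045 + h167 + 1 / 2 * h246 - h247 - 1 / 2 * h356
  have a53 : A 5 3 = -1 / 2 * A 7 1 := by
    linear_combination -h067 + 1 / 2 * h145 + 1 / 2 * h256 + 1 / 2 * h346 - h347
  have a55 : A 5 5 = 0 := by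
    linear_combination 1 / 6 * h016 - 1 / 3 * h017 - 1 / 6 * h024 - 1 / 3 * h035 + 1 / 3 * h125
      - 1 / 6 * h134 - 1 / 6 * h236 + 1 / 3 * h237 - 1 / 6 * h456 + 1 / 3 * h457
  have a56 : A 5 6 = 0 := by
    linear_combination h467
  have a57 : A 5 7 = -1 / 4 * A 7 5 := by
    linear_combination 1 / 4 * h015 + 1 / 4 * h036 - 1 / 2 * h037 - 1 / 4 * h126 + 1 / 2 * h127
      - 1 / 4 * h235 + 1 / 2 * h467
  have a60 : A 6 0 = A 7 0 := by
    linear_combination h023 - h045 - 2 * h167 - h246 + h247 + h356 - h357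
  have a61 : A 6 1 = A 7 1 := by
    linear_combination 2 * h067 + h123 - h145 - h256 + h257 - h346 + h347
  have a62 : A 6 2 = -2 * A 7 2 := by
    linear_combination h012 + h047 + h157 + h245 + 2 * h367
  have a63 : A 6 3 = -2 * A 7 3 := by
    linear_combination h013 - h057 + h147 - 2 * h267 + h345
  have a64 : A 6 4 = -1 / 2 * A 7 4 := by
    linear_combination 1 / 2 * h014 - 1 / 2 * h026 - 1 / 2 * h136 + 1 / 2 * h234 - h567
  have a65 : A 6 5 = -1 / 2 * A 7 5 := by
    linear_combination 1 / 2 * h015 + 1 / 2 * h036 - 1 / 2 * h126 + 1 / 2 * h235 + h467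
  have a66 : A 6 6 = 0 := by
    linear_combination 2 / 3 * h016 - 1 / 3 * h017 - 1 / 6 * h024 + 1 / 6 * h035 - 1 / 6 * h125
      - 1 / 6 * h134 + 1 / 3 * h236 + 1 / 3 * h237 - 2 / 3 * h456 + 1 / 3 * h457
  have a67 : A 6 7 = 0 := by
    linear_combination h237
  have a76 : A 7 6 = 0 := by
    linear_combination h456
  have a77 : A 7 7 = 0 := by
    linear_combination -1 / 3 * h016 + 2 / 3 * h017 - 1 / 6 * h024 + 1 / 6 * h035 - 1 / 6 * h125
      - 1 / 6 * h134 + 1 / 3 * h236 - 2 / 3 * h237 + 1 / 3 * h456 + 1 / 3 * h457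
  simp only [Matrix.trace, Matrix.diag_apply, Matrix.mul_apply, Fin.sum_univ_eight]
  simp only [a00, a01, a02, a03, a04, a05, a06, a07, a10, a11, a12, a13, a14, a15, a16, a17,
    a20, a21, a22, a23, a24, a25, a26, a27, a30, a31, a33, a34, a35, a36, a37, a40, a41, a42,
    a43, a44, a45, a46, a47, a50, a51, a52, a53, a55, a56, a57, a60, a61, a62, a63, a64, a65,
    a66, a67, a76, a77]
  ring

/-- The trace form is negative semidefinite on the infinitesimal symmetries of `phiThree`. -/
lemma IsSymmetry.trace_sq_nonpos_of_phiThree {A : Matrix (Fin 8) (Fin 8) ℝ}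
    (hA : IsSymmetry phiThree A) : (A * A).trace ≤ 0 := by
  rw [hA.trace_sq_of_phiThree]
  nlinarith [sq_nonneg (A 3 2), sq_nonneg (A 5 4), sq_nonneg (A 3 2 + A 5 4),
    sq_nonneg (A 7 0), sq_nonneg (A 7 1), sq_nonneg (A 7 2), sq_nonneg (A 7 3),
    sq_nonneg (A 7 4), sq_nonneg (A 7 5)]

lemma IsSymmetry.trace_sq_of_phiTwo {A : Matrix (Fin 8) (Fin 8) ℝ} (hA : IsSymmetry phiTwo A) :
    (A * A).trace = -4 * A 3 2 ^ 2 - 6 * A 6 2 * A 7 1 + 6 * A 6 3 * A 7 0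
      + 3 * A 6 5 * A 7 5 + 3 * A 7 7 ^ 2 := by
  have h012 := hA (e 0) (e 1) (e 2)
  have h013 := hA (e 0) (e 1) (e 3)
  have h014 := hA (e 0) (e 1) (e 4)
  have h015 := hA (e 0) (e 1) (e 5)
  have h016 := hA (e 0) (e 1) (e 6)
  have h017 := hA (e 0) (e 1) (e 7)
  have h023 := hA (e 0) (e 2) (e 3)
  have h024 := hA (e 0) (e 2) (e 4)
  have h025 := hA (e 0) (e 2) (e 5)
  have h026 := hA (e 0) (e 2) (e 6)
  have h027 := hA (e 0) (e 2) (e 7)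
  have h034 := hA (e 0) (e 3) (e 4)
  have h035 := hA (e 0) (e 3) (e 5)
  have h036 := hA (e 0) (e 3) (e 6)
  have h037 := hA (e 0) (e 3) (e 7)
  have h045 := hA (e 0) (e 4) (e 5)
  have h046 := hA (e 0) (e 4) (e 6)
  have h047 := hA (e 0) (e 4) (e 7)
  have h056 := hA (e 0) (e 5) (e 6)
  have h057 := hA (e 0) (e 5) (e 7)
  have h067 := hA (e 0) (e 6) (e 7)
  have h123 := hA (e 1) (e 2) (e 3)
  have h124 := hA (e 1) (e 2) (e 4)
  have h125 := hA (e 1) (e 2) (e 5)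
  have h126 := hA (e 1) (e 2) (e 6)
  have h127 := hA (e 1) (e 2) (e 7)
  have h134 := hA (e 1) (e 3) (e 4)
  have h135 := hA (e 1) (e 3) (e 5)
  have h136 := hA (e 1) (e 3) (e 6)
  have h137 := hA (e 1) (e 3) (e 7)
  have h145 := hA (e 1) (e 4) (e 5)
  have h146 := hA (e 1) (e 4) (e 6)
  have h147 := hA (e 1) (e 4) (e 7)
  have h156 := hA (e 1) (e 5) (e 6)
  have h157 := hA (e 1) (e 5) (e 7)
  have h167 := hA (e 1) (e 6) (e 7)
  have h234 := hA (e 2) (e 3) (e 4)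
  have h235 := hA (e 2) (e 3) (e 5)
  have h236 := hA (e 2) (e 3) (e 6)
  have h237 := hA (e 2) (e 3) (e 7)
  have h245 := hA (e 2) (e 4) (e 5)
  have h246 := hA (e 2) (e 4) (e 6)
  have h247 := hA (e 2) (e 4) (e 7)
  have h256 := hA (e 2) (e 5) (e 6)
  have h257 := hA (e 2) (e 5) (e 7)
  have h267 := hA (e 2) (e 6) (e 7)
  have h345 := hA (e 3) (e 4) (e 5)
  have h346 := hA (e 3) (e 4) (e 6)
  have h347 := hA (e 3) (e 4) (e 7)
  have h356 := hA (e 3) (e 5) (e 6)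
  have h357 := hA (e 3) (e 5) (e 7)
  have h367 := hA (e 3) (e 6) (e 7)
  have h456 := hA (e 4) (e 5) (e 6)
  have h457 := hA (e 4) (e 5) (e 7)
  have h467 := hA (e 4) (e 6) (e 7)
  have h567 := hA (e 5) (e 6) (e 7)
  simp [phiTwo, eee_apply, -neg_eq_zero] at h012 h013 h014 h015 h016 h017 h023 h024 h025 h026
  simp [phiTwo, eee_apply, -neg_eq_zero] at h027 h034 h035 h036 h037 h045 h046 h047 h056 h057
  simp [phiTwo, eee_apply, -neg_eq_zero] at h067 h123 h124 h125 h126 h127 h134 h135 h136 h137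
  simp [phiTwo, eee_apply, -neg_eq_zero] at h145 h146 h147 h156 h157 h167 h234 h235 h236 h237
  simp [phiTwo, eee_apply, -neg_eq_zero] at h245 h246 h247 h256 h257 h267 h345 h346 h347 h356
  simp [phiTwo, eee_apply, -neg_eq_zero] at h357 h367 h456 h457 h467 h567
  have a00 : A 0 0 = 1 / 2 * A 7 7 := by
    linear_combination 1 / 3 * h016 + 1 / 4 * h024 + 5 / 12 * h035 + 1 / 12 * h125 - 1 / 4 *
      h134 - 1 / 6 * h237 - 1 / 3 * h567
  have a01 : A 0 1 = -A 3 2 := by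
    linear_combination h124 + h467
  have a02 : A 0 2 = -1 / 2 * A 7 5 := by
    linear_combination -1 / 2 * h036 - 1 / 2 * h126 + 1 / 2 * h235
  have a03 : A 0 3 = 0 := by
    linear_combination 1 / 2 * h026 - 1 / 2 * h136 - 1 / 2 * h234 + 1 / 2 * h456
  have a04 : A 0 4 = -1 / 2 * A 7 0 := by
    linear_combination 1 / 2 * h056 - 1 / 2 * h146 - 1 / 2 * h345
  have a05 : A 0 5 = 1 / 2 * A 7 1 := by
    linear_combination -1 / 2 * h046 - 1 / 2 * h156 + 1 / 2 * h245
  have a06 : A 0 6 = 0 := by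
    linear_combination h246
  have a07 : A 0 7 = 1 / 2 * A 6 3 := by
    linear_combination -1 / 2 * h045 + 1 / 2 * h247 + 1 / 2 * h357
  have a10 : A 1 0 = A 3 2 := by
    linear_combination -1 / 2 * h025 + 1 / 2 * h034 - 1 / 2 * h124 + 1 / 2 * h135 - h467
  have a11 : A 1 1 = 1 / 2 * A 7 7 := by
    linear_combination 1 / 3 * h016 - 1 / 4 * h024 - 1 / 12 * h035 - 5 / 12 * h125 + 1 / 4 *
      h134 - 1 / 6 * h237 - 1 / 3 * h567
  have a12 : A 1 2 = 0 := by
    linear_combination 1 / 2 * h026 - 1 / 2 * h136 + 1 / 2 * h234 - 1 / 2 * h456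
  have a13 : A 1 3 = -1 / 2 * A 7 5 := by
    linear_combination 1 / 2 * h036 + 1 / 2 * h126 + 1 / 2 * h235
  have a14 : A 1 4 = -1 / 2 * A 7 1 := by
    linear_combination 1 / 2 * h046 + 1 / 2 * h156 + 1 / 2 * h245
  have a15 : A 1 5 = -1 / 2 * A 7 0 := by
    linear_combination 1 / 2 * h056 - 1 / 2 * h146 + 1 / 2 * h345
  have a16 : A 1 6 = 0 := by
    linear_combination h346
  have a17 : A 1 7 = -1 / 2 * A 6 2 := by
    linear_combination -1 / 2 * h145 - 1 / 2 * h257 + 1 / 2 * h347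
  have a20 : A 2 0 = -1 / 2 * A 6 5 := by
    linear_combination 1 / 2 * h015 + 1 / 2 * h037 + 1 / 2 * h127
  have a21 : A 2 1 = 0 := by
    linear_combination 1 / 2 * h014 - 1 / 2 * h027 + 1 / 2 * h137 + 1 / 2 * h457
  have a22 : A 2 2 = -1 / 2 * A 7 7 := by
    linear_combination 1 / 4 * h024 - 1 / 4 * h035 - 1 / 4 * h125 - 1 / 4 * h134 + 1 / 2 * h237
  have a23 : A 2 3 = -A 3 2 := by
    linear_combination 1 / 2 * h025 + 1 / 2 * h034 + 1 / 2 * h124 - 1 / 2 * h135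
  have a24 : A 2 4 = -1 / 2 * A 6 2 := by
    linear_combination -1 / 2 * h145 - 1 / 2 * h257 - 1 / 2 * h347
  have a25 : A 2 5 = -1 / 2 * A 6 3 := by
    linear_combination -1 / 2 * h045 + 1 / 2 * h247 - 1 / 2 * h357
  have a26 : A 2 6 = -1 / 2 * A 7 1 := by
    linear_combination -1 / 2 * h046 + 1 / 2 * h156 + 1 / 2 * h245
  have a27 : A 2 7 = 0 := by
    linear_combination -h047
  have a30 : A 3 0 = 0 := by
    linear_combination -1 / 2 * h014 - 1 / 2 * h027 + 1 / 2 * h137 - 1 / 2 * h457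
  have a31 : A 3 1 = -1 / 2 * A 6 5 := by
    linear_combination 1 / 2 * h015 - 1 / 2 * h037 - 1 / 2 * h127
  have a33 : A 3 3 = -1 / 2 * A 7 7 := by
    linear_combination -1 / 4 * h024 + 1 / 4 * h035 + 1 / 4 * h125 + 1 / 4 * h134 + 1 / 2 * h237
  have a34 : A 3 4 = -1 / 2 * A 6 3 := by
    linear_combination 1 / 2 * h045 + 1 / 2 * h247 - 1 / 2 * h357
  have a35 : A 3 5 = 1 / 2 * A 6 2 := by
    linear_combination -1 / 2 * h145 + 1 / 2 * h257 + 1 / 2 * h347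
  have a36 : A 3 6 = 1 / 2 * A 7 0 := by
    linear_combination -1 / 2 * h056 - 1 / 2 * h146 + 1 / 2 * h345
  have a37 : A 3 7 = 0 := by
    linear_combination -h147
  have a40 : A 4 0 = -3 / 2 * A 6 3 := by
    linear_combination h013 + 1 / 2 * h045 + h167 - 1 / 2 * h247 - 1 / 2 * h357
  have a41 : A 4 1 = 3 / 2 * A 6 2 := by
    linear_combination -h012 - h067 + 1 / 2 * h145 + 1 / 2 * h257 - 1 / 2 * h347
  have a42 : A 4 2 = 3 / 2 * A 7 1 := by
    linear_combination 1 / 2 * h046 - h123 - 1 / 2 * h156 - 1 / 2 * h245 - h367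
  have a43 : A 4 3 = -3 / 2 * A 7 0 := by
    linear_combination h023 + 1 / 2 * h056 + 1 / 2 * h146 + h267 - 1 / 2 * h345
  have a44 : A 4 4 = 0 := by
    linear_combination -1 / 3 * h016 + 1 / 2 * h024 - 1 / 6 * h035 + 1 / 6 * h125 + 1 / 2 * h134
      - 1 / 3 * h237 + 1 / 3 * h567
  have a45 : A 4 5 = 0 := by
    linear_combination 1 / 2 * h025 + 1 / 2 * h034 - 1 / 2 * h124 + 1 / 2 * h135 - h467
  have a46 : A 4 6 = 0 := by
    linear_combination 1 / 2 * h026 + 1 / 2 * h136 - 1 / 2 * h234 + 1 / 2 * h456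
  have a47 : A 4 7 = 0 := by
    linear_combination -1 / 2 * h014 + 1 / 2 * h027 + 1 / 2 * h137 - 1 / 2 * h457
  have a50 : A 5 0 = -1 / 2 * A 6 2 := by
    linear_combination h067 - 1 / 2 * h145 - 1 / 2 * h257 + 1 / 2 * h347
  have a51 : A 5 1 = -1 / 2 * A 6 3 := by
    linear_combination 1 / 2 * h045 + h167 - 1 / 2 * h247 - 1 / 2 * h357
  have a52 : A 5 2 = -1 / 2 * A 7 0 := by
    linear_combination 1 / 2 * h056 + 1 / 2 * h146 + h267 - 1 / 2 * h345
  have a53 : A 5 3 = -1 / 2 * A 7 1 := by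
    linear_combination -1 / 2 * h046 + 1 / 2 * h156 + 1 / 2 * h245 + h367
  have a54 : A 5 4 = 0 := by
    linear_combination h467
  have a55 : A 5 5 = 0 := by
    linear_combination -1 / 3 * h016 + 1 / 3 * h035 - 1 / 3 * h125 - 1 / 3 * h237 + 1 / 3 * h567
  have a56 : A 5 6 = 1 / 2 * A 7 5 := by
    linear_combination 1 / 2 * h036 - 1 / 2 * h126 - 1 / 2 * h235
  have a57 : A 5 7 = 1 / 2 * A 6 5 := by
    linear_combination -1 / 2 * h015 + 1 / 2 * h037 - 1 / 2 * h127
  have a60 : A 6 0 = 0 := by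
    linear_combination -h057 + h147
  have a61 : A 6 1 = 0 := by
    linear_combination -h047 - h157
  have a64 : A 6 4 = 0 := by
    linear_combination -h457
  have a66 : A 6 6 = -A 7 7 := by
    linear_combination 1 / 3 * h016 - 1 / 3 * h035 + 1 / 3 * h125 + 1 / 3 * h237 + 2 / 3 * h567
  have a67 : A 6 7 = 0 := by
    linear_combination h017
  have a72 : A 7 2 = 0 := by
    linear_combination h256 + h346
  have a73 : A 7 3 = 0 := by
    linear_combination -h246 + h356
  have a74 : A 7 4 = 0 := by
    linear_combination h456
  have a76 : A 7 6 = 0 := by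
    linear_combination h236
  simp only [Matrix.trace, Matrix.diag_apply, Matrix.mul_apply, Fin.sum_univ_eight]
  simp only [a00, a01, a02, a03, a04, a05, a06, a07, a10, a11, a12, a13, a14, a15, a16, a17,
    a20, a21, a22, a23, a24, a25, a26, a27, a30, a31, a33, a34, a35, a36, a37, a40, a41, a42,
    a43, a44, a45, a46, a47, a50, a51, a52, a53, a54, a55, a56, a57, a60, a61, a64, a66, a67,
    a72, a73, a74, a76]
  ring

/-- The trace form on the infinitesimal symmetries of `phiTwo` is nonpositive on a subspace of
codimension four. -/
lemma IsSymmetry.trace_sq_nonpos_of_phiTwo {A : Matrix (Fin 8) (Fin 8) ℝ}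
    (hA : IsSymmetry phiTwo A) (h1 : A 7 7 = 0) (h2 : A 6 2 - A 7 1 = 0)
    (h3 : A 6 3 + A 7 0 = 0) (h4 : A 6 5 + A 7 5 = 0) : (A * A).trace ≤ 0 := by
  rw [hA.trace_sq_of_phiTwo, h1, sub_eq_zero.1 h2, eq_neg_of_add_eq_zero_left h3,
    eq_neg_of_add_eq_zero_left h4]
  nlinarith [sq_nonneg (A 3 2), sq_nonneg (A 7 1), sq_nonneg (A 7 0), sq_nonneg (A 7 5)]

variable {φ ψ : ThreeForm}

lemma exists_symmetry_conj (hφ : φ ∈ orbit γ) (hψ : ψ ∈ orbit γ) :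
    ∃ P Q : Matrix (Fin 8) (Fin 8) ℝ, ∀ A, IsSymmetry φ A → IsSymmetry ψ (Q * A * P) ∧
      ((Q * A * P) * (Q * A * P)).trace = (A * A).trace := by
  obtain ⟨g, rfl⟩ := hφ
  obtain ⟨h, rfl⟩ := hψ
  set P := LinearMap.toMatrix' (h.trans g.symm).toLinearMap with hP
  set Q := LinearMap.toMatrix' (g.trans h.symm).toLinearMap with hQ
  have hPx : ∀ x, P.mulVec x = g.symm (h x) := fun x => by
    simp [hP, LinearMap.toMatrix'_mulVec]
  have hQx : ∀ x, Q.mulVec x = h.symm (g x) := fun x => by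
    simp [hQ, LinearMap.toMatrix'_mulVec]
  have hPQ : P * Q = 1 := by
    rw [hP, hQ, ← LinearMap.toMatrix'_comp, ← LinearMap.toMatrix'_id]
    exact congrArg _ (LinearMap.ext fun x => by simp)
  refine ⟨P, Q, fun A hA => ⟨fun x y z => ?_, ?_⟩⟩
  · have := hA (P.mulVec x) (P.mulVec y) (P.mulVec z)
    simp only [formPullback_apply, LinearEquiv.coe_coe, hPx, LinearEquiv.apply_symm_apply] at this
    simpa only [formPullback_apply, LinearEquiv.coe_coe, ← Matrix.mulVec_mulVec, hPx, hQx,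
      LinearEquiv.apply_symm_apply] using this
  · calc ((Q * A * P) * (Q * A * P)).trace = (Q * (A * (P * Q) * A * P)).trace := by
          simp only [mul_assoc]
      _ = (A * A).trace := by
          rw [Matrix.trace_mul_comm, hPQ, mul_one, mul_assoc, mul_assoc, hPQ, mul_one]

/-- A family of infinitesimal symmetries of `phiOne` on which the trace form is positive. -/
def phiOneSymmetry (p : Fin 5 → ℝ) : Matrix (Fin 8) (Fin 8) ℝ :=
  !![p 0 + p 1, -p 4, -p 4, 0, 0, -p 2, 0, -p 3;
    -p 4, 0, 0, -p 4, -2 * p 3, -2 * p 3, -p 2, -p 2;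
    -p 4, 0, 0, -p 4, p 3, p 3, 2 * p 2, 2 * p 2;
    0, -p 4, -p 4, -p 0 - p 1, p 2, 0, p 3, 0;
    0, -p 3, 0, p 2, -p 0, 0, 0, -p 4;
    -p 2, -p 3, 0, 0, 0, p 0, p 4, 0;
    0, 0, p 2, p 3, 0, p 4, -p 1, 0;
    -p 3, 0, p 2, 0, -p 4, 0, 0, p 1]

lemma isSymmetry_phiOneSymmetry (p : Fin 5 → ℝ) : IsSymmetry phiOne (phiOneSymmetry p) := by
  intro x y z
  simp only [phiOneSymmetry, phiOne, AlternatingMap.add_apply, eee_apply, Matrix.mulVec,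
    dotProduct, Fin.sum_univ_eight]
  simp
  ring

lemma trace_phiOneSymmetry_sq (p : Fin 5 → ℝ) :
    (phiOneSymmetry p * phiOneSymmetry p).trace = 2 * (p 0 ^ 2 + p 1 ^ 2 + (p 0 + p 1) ^ 2)
      + 12 * (p 2 ^ 2 + p 3 ^ 2 + p 4 ^ 2) := by
  simp only [phiOneSymmetry, Matrix.trace, Matrix.diag_apply, Matrix.mul_apply,
    Fin.sum_univ_eight]
  simp
  ring

lemma trace_phiOneSymmetry_sq_pos {p : Fin 5 → ℝ} (hp : p ≠ 0) :
    0 < (phiOneSymmetry p * phiOneSymmetry p).trace := by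
  rw [trace_phiOneSymmetry_sq]
  by_contra! h
  refine hp (funext fun i => pow_eq_zero_iff two_ne_zero |>.1 ?_)
  fin_cases i <;> simp <;> nlinarith [sq_nonneg (p 0), sq_nonneg (p 1), sq_nonneg (p 0 + p 1),
    sq_nonneg (p 2), sq_nonneg (p 3), sq_nonneg (p 4)]

lemma phiOneSymmetry_add (p q : Fin 5 → ℝ) :
    phiOneSymmetry (p + q) = phiOneSymmetry p + phiOneSymmetry q := by
  ext i j
  fin_cases i <;> fin_cases j <;> simp [phiOneSymmetry] <;> ring

lemma phiOneSymmetry_smul (r : ℝ) (p : Fin 5 → ℝ) :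
    phiOneSymmetry (r • p) = r • phiOneSymmetry p := by
  ext i j
  fin_cases i <;> fin_cases j <;> simp [phiOneSymmetry] <;> ring

/-- An infinitesimal symmetry of `phiTwo` with positive trace form. -/
lemma exists_isSymmetry_phiTwo : ∃ A, IsSymmetry phiTwo A ∧ 0 < (A * A).trace := by
  refine ⟨Matrix.diagonal ![1 / 2, 1 / 2, -1 / 2, -1 / 2, 0, 0, -1, 1], fun x y z => ?_, ?_⟩
  · simp only [phiTwo, AlternatingMap.add_apply, AlternatingMap.sub_apply, eee_apply,
      Matrix.mulVec_diagonal, Matrix.cons_val]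
    ring
  · simp only [Matrix.diagonal_mul_diagonal, Matrix.trace_diagonal, Fin.sum_univ_eight,
      Matrix.cons_val]
    norm_num

lemma phiThree_notMem_orbit_of_phiTwo (h2 : phiTwo ∈ orbit γ) : phiThree ∉ orbit γ := by
  intro h3
  obtain ⟨P, Q, H⟩ := exists_symmetry_conj h2 h3
  obtain ⟨A, hA, hpos⟩ := exists_isSymmetry_phiTwo
  obtain ⟨hB, htr⟩ := H A hA
  linarith [hB.trace_sq_nonpos_of_phiThree]

lemma phiThree_notMem_orbit_of_phiOne (h1 : phiOne ∈ orbit γ) : phiThree ∉ orbit γ := by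
  intro h3
  obtain ⟨P, Q, H⟩ := exists_symmetry_conj h1 h3
  obtain ⟨hB, htr⟩ := H _ (isSymmetry_phiOneSymmetry (Pi.single 0 1))
  linarith [hB.trace_sq_nonpos_of_phiThree,
    trace_phiOneSymmetry_sq_pos (p := Pi.single 0 1) (by simp)]

lemma phiTwo_notMem_orbit_of_phiOne (h1 : phiOne ∈ orbit γ) : phiTwo ∉ orbit γ := by
  intro h2
  obtain ⟨P, Q, H⟩ := exists_symmetry_conj h1 h2
  let S : (Fin 5 → ℝ) →ₗ[ℝ] Matrix (Fin 8) (Fin 8) ℝ :=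
    { toFun := fun p => Q * phiOneSymmetry p * P
      map_add' := fun p q => by rw [phiOneSymmetry_add, mul_add, add_mul]
      map_smul' := fun r p => by
        rw [phiOneSymmetry_smul, Matrix.mul_smul, Matrix.smul_mul, RingHom.id_apply] }
  let E (i j : Fin 8) : (Fin 5 → ℝ) →ₗ[ℝ] ℝ := Matrix.entryLinearMap ℝ ℝ i j ∘ₗ S
  let f : (Fin 5 → ℝ) →ₗ[ℝ] (Fin 4 → ℝ) :=
    LinearMap.pi ![E 7 7, E 6 2 - E 7 1, E 6 3 + E 7 0, E 6 5 + E 7 5]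
  obtain ⟨p, hp, hp0⟩ := (Submodule.ne_bot_iff _).1
    (LinearMap.ker_ne_bot_of_finrank_lt (f := f) (by simp))
  obtain ⟨hB, htr⟩ := H _ (isSymmetry_phiOneSymmetry p)
  have hf : ∀ i, f p i = 0 := congrFun hp
  linarith [hB.trace_sq_nonpos_of_phiTwo (hf 0) (hf 1) (hf 2) (hf 3),
    trace_phiOneSymmetry_sq_pos hp0]

end ThreeForm

/-- Every stable 3-form on `ℝ⁸` is equivalent to exactly one of `φ₁`, `φ₂`, `φ₃`. -/
theorem stable_three_form_dim_eight_classification (γ : (Fin 8 → ℝ) [⋀^Fin 3]→ₗ[ℝ] ℝ)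
    (hγ : IsStableForm γ) :
    ((∃ g : (Fin 8 → ℝ) ≃ₗ[ℝ] (Fin 8 → ℝ), formPullback g.toLinearMap γ = phiOne) ∨
     (∃ g : (Fin 8 → ℝ) ≃ₗ[ℝ] (Fin 8 → ℝ), formPullback g.toLinearMap γ = phiTwo) ∨
     (∃ g : (Fin 8 → ℝ) ≃ₗ[ℝ] (Fin 8 → ℝ), formPullback g.toLinearMap γ = phiThree)) ∧
    ¬ ((∃ g : (Fin 8 → ℝ) ≃ₗ[ℝ] (Fin 8 → ℝ), formPullback g.toLinearMap γ = phiOne) ∧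
       (∃ g : (Fin 8 → ℝ) ≃ₗ[ℝ] (Fin 8 → ℝ), formPullback g.toLinearMap γ = phiTwo)) ∧
    ¬ ((∃ g : (Fin 8 → ℝ) ≃ₗ[ℝ] (Fin 8 → ℝ), formPullback g.toLinearMap γ = phiOne) ∧
       (∃ g : (Fin 8 → ℝ) ≃ₗ[ℝ] (Fin 8 → ℝ), formPullback g.toLinearMap γ = phiThree)) ∧
    ¬ ((∃ g : (Fin 8 → ℝ) ≃ₗ[ℝ] (Fin 8 → ℝ), formPullback g.toLinearMap γ = phiTwo) ∧
       (∃ g : (Fin 8 → ℝ) ≃ₗ[ℝ] (Fin 8 → ℝ), formPullback g.toLinearMap γ = phiThree)) := by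
  refine ⟨?_, ?_, ?_, ?_⟩
  · rcases ThreeForm.exists_model_mem_orbit hγ with ⟨g, hg⟩ | ⟨g, hg⟩ | ⟨g, hg⟩
    · exact Or.inl ⟨g, hg.symm⟩
    · exact Or.inr (Or.inl ⟨g, hg.symm⟩)
    · exact Or.inr (Or.inr ⟨g, hg.symm⟩)
  · rintro ⟨⟨g, hg⟩, h, hh⟩
    exact ThreeForm.phiTwo_notMem_orbit_of_phiOne ⟨g, hg.symm⟩ ⟨h, hh.symm⟩
  · rintro ⟨⟨g, hg⟩, h, hh⟩
    exact ThreeForm.phiThree_notMem_orbit_of_phiOne ⟨g, hg.symm⟩ ⟨h, hh.symm⟩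
  · rintro ⟨⟨g, hg⟩, h, hh⟩
    exact ThreeForm.phiThree_notMem_orbit_of_phiTwo ⟨g, hg.symm⟩ ⟨h, hh.symm⟩
end
end

section
/- Let ω be a non-degenerate 3-form on ℝ^8, and let g ∈ GL(8,ℝ) satisfy g^*ω = ω and det g > 0. Then det g = 1. -/
noncomputable section

/-- The wedge product of real-valued alternating forms (via `AlternatingMap.domCoprod`). -/
def awedge {V : Type*} [AddCommGroup V] [Module ℝ V] {p q : ℕ}
    (α : V [⋀^Fin p]→ₗ[ℝ] ℝ) (β : V [⋀^Fin q]→ₗ[ℝ] ℝ) : V [⋀^Fin (p + q)]→ₗ[ℝ] ℝ :=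
  ((TensorProduct.lid ℝ ℝ).toLinearMap.compAlternatingMap (α.domCoprod β)).domDomCongr
    finSumFinEquiv

/-- The standard volume form `θ = e^1 ∧ ⋯ ∧ e^8` on `ℝ⁸`: the determinant form on the
standard basis. -/
def volForm : (Fin 8 → ℝ) [⋀^Fin 8]→ₗ[ℝ] ℝ := Matrix.detRowAlternating

/-- `mul` is the reduced multiplication of the 3-form `ω`: for all `v, w`, the vector
`v·w = mul v w` satisfies `(v·w) ⌟ θ = (v ⌟ ω) ∧ (w ⌟ ω) ∧ ω`, where `⌟` is insertion in
the first slot. -/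
def IsReducedMul (ω : (Fin 8 → ℝ) [⋀^Fin 3]→ₗ[ℝ] ℝ)
    (mul : (Fin 8 → ℝ) →ₗ[ℝ] (Fin 8 → ℝ) →ₗ[ℝ] (Fin 8 → ℝ)) : Prop :=
  ∀ v w : Fin 8 → ℝ,
    volForm.curryLeft (mul v w) = awedge (awedge (ω.curryLeft v) (ω.curryLeft w)) ω

/-- The reduced trace form `b^ω(v,w) = Tr (L_v ∘ L_w)`, where `L_v(w) = v·w = mul v w`. -/
def reducedTraceForm (mul : (Fin 8 → ℝ) →ₗ[ℝ] (Fin 8 → ℝ) →ₗ[ℝ] (Fin 8 → ℝ))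
    (v w : Fin 8 → ℝ) : ℝ :=
  LinearMap.trace ℝ (Fin 8 → ℝ) (mul v ∘ₗ mul w)

/-- Pullback commutes with the wedge product. -/
theorem awedge_compLinearMap {V W : Type*} [AddCommGroup V] [Module ℝ V] [AddCommGroup W]
    [Module ℝ W] {p q : ℕ} (α : V [⋀^Fin p]→ₗ[ℝ] ℝ) (β : V [⋀^Fin q]→ₗ[ℝ] ℝ) (g : W →ₗ[ℝ] V) :
    (awedge α β).compLinearMap g = awedge (α.compLinearMap g) (β.compLinearMap g) := by
  ext v
  simp only [awedge, AlternatingMap.compLinearMap_apply, AlternatingMap.domDomCongr_apply,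
    LinearMap.compAlternatingMap_apply, AlternatingMap.domCoprod_apply, sum_apply,
    map_sum]
  refine Finset.sum_congr rfl fun σ _ => ?_
  induction σ using Quotient.inductionOn' with | _ σ
  rfl

/-- Pulling back the insertion of `g v` into a form that `g` rescales by `c` gives the insertion of
`v`, rescaled by `c`. -/
theorem compLinearMap_curryLeft_map {V : Type*} [AddCommGroup V] [Module ℝ V] {n : ℕ}
    {θ : V [⋀^Fin (n + 1)]→ₗ[ℝ] ℝ} {g : V →ₗ[ℝ] V} {c : ℝ} (h : θ.compLinearMap g = c • θ) (v : V) :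
    (θ.curryLeft (g v)).compLinearMap g = c • θ.curryLeft v := by
  rw [← AlternatingMap.curryLeft_compLinearMap, h]
  rfl

/-- If an automorphism `g` rescales `θ` by `c`, and insertion into `θ` is injective, then pulling
back insertions by `g` intertwines them up to `c`. -/
theorem smul_eq_map_of_compLinearMap_curryLeft {V : Type*} [AddCommGroup V] [Module ℝ V] {n : ℕ}
    {θ : V [⋀^Fin (n + 1)]→ₗ[ℝ] ℝ} (hθ : Function.Injective θ.curryLeft) (g : V ≃ₗ[ℝ] V) {c : ℝ}
    (h : θ.compLinearMap g.toLinearMap = c • θ) {a u : V}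
    (hau : (θ.curryLeft a).compLinearMap g.toLinearMap = θ.curryLeft u) : c • a = g u := by
  apply hθ
  have hcomp := compLinearMap_curryLeft_map h u
  rw [← hau] at hcomp
  rw [map_smul]
  ext x
  have hx := DFunLike.congr_fun hcomp fun i => g.symm (x i)
  simp only [AlternatingMap.compLinearMap_apply, LinearEquiv.coe_coe,
    LinearEquiv.apply_symm_apply, AlternatingMap.smul_apply] at hx
  exact hx.symm

/-- The pullback of the determinant form by an endomorphism is its determinant multiple. -/
theorem basisFun_det_compLinearMap {n : ℕ} (g : (Fin n → ℝ) →ₗ[ℝ] (Fin n → ℝ)) :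
    (Pi.basisFun ℝ (Fin n)).det.compLinearMap g =
      LinearMap.det g • (Pi.basisFun ℝ (Fin n)).det := by
  ext v
  rw [AlternatingMap.compLinearMap_apply, AlternatingMap.smul_apply, smul_eq_mul,
    ← Module.Basis.det_comp]
  rfl

/-- A vector is determined by its insertion into the determinant form. -/
theorem basisFun_det_curryLeft_injective {n : ℕ} :
    Function.Injective (Pi.basisFun ℝ (Fin (n + 1))).det.curryLeft := by
  refine (injective_iff_map_eq_zero _).2 fun a ha => ?_
  by_contra hne
  obtain ⟨A, hA⟩ := SeparatingDual.exists_continuousLinearEquiv_apply_eq (R := ℝ)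
    (x := (Pi.single 0 1 : Fin (n + 1) → ℝ)) (y := a) (by simp) hne
  have hdet := DFunLike.congr_fun (basisFun_det_compLinearMap A.toLinearEquiv.toLinearMap)
    fun i => Pi.basisFun ℝ (Fin (n + 1)) i
  have hzero := DFunLike.congr_fun ha fun i => A (Pi.basisFun ℝ (Fin (n + 1)) i.succ)
  have hcons : (Matrix.vecCons a fun i : Fin n => A (Pi.basisFun ℝ (Fin (n + 1)) i.succ)) =
      fun i => A (Pi.basisFun ℝ (Fin (n + 1)) i) := by
    ext i : 1
    refine Fin.cases ?_ (fun j => ?_) i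
    · simp [hA]
    · simp
  rw [AlternatingMap.curryLeft_apply_apply, hcons] at hzero
  rw [AlternatingMap.smul_apply, Module.Basis.det_self, smul_eq_mul, mul_one] at hdet
  exact (LinearEquiv.isUnit_det' A.toLinearEquiv).ne_zero (hdet.symm.trans hzero)

theorem volForm_eq_basisFun_det : volForm = (Pi.basisFun ℝ (Fin 8)).det :=
  Pi.basisFun_det.symm

/-- Twisting both arguments by an automorphism fixing `ω` and pulling back leaves the 7-form that
defines the reduced multiplication unchanged. -/
theorem awedge_curryLeft_map_map {V : Type*} [AddCommGroup V] [Module ℝ V]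
    {ω : V [⋀^Fin 3]→ₗ[ℝ] ℝ} {g : V →ₗ[ℝ] V} (hg : ω.compLinearMap g = ω) (v w : V) :
    (awedge (awedge (ω.curryLeft (g v)) (ω.curryLeft (g w))) ω).compLinearMap g =
      awedge (awedge (ω.curryLeft v) (ω.curryLeft w)) ω := by
  have hω (u : V) : (ω.curryLeft (g u)).compLinearMap g = ω.curryLeft u := by
    rw [← AlternatingMap.curryLeft_compLinearMap, hg]
  rw [awedge_compLinearMap, awedge_compLinearMap, hω, hω, hg]

/-- An automorphism fixing `ω` and rescaling a form `θ` by `c` rescales by `c` the multiplication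
defined from `ω` and `θ`. -/
theorem smul_mul_map_map {V : Type*} [AddCommGroup V] [Module ℝ V]
    {θ : V [⋀^Fin 8]→ₗ[ℝ] ℝ} {ω : V [⋀^Fin 3]→ₗ[ℝ] ℝ} {mul : V →ₗ[ℝ] V →ₗ[ℝ] V}
    (hmul : ∀ v w, θ.curryLeft (mul v w) = awedge (awedge (ω.curryLeft v) (ω.curryLeft w)) ω)
    (hθ : Function.Injective θ.curryLeft) (g : V ≃ₗ[ℝ] V) {c : ℝ}
    (hgθ : θ.compLinearMap g.toLinearMap = c • θ) (hg : ω.compLinearMap g.toLinearMap = ω)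
    (v w : V) : c • mul (g v) (g w) = g (mul v w) := by
  refine smul_eq_map_of_compLinearMap_curryLeft hθ g hgθ ?_
  rw [hmul, hmul]
  exact awedge_curryLeft_map_map hg v w

/-- A linear automorphism fixing `ω` scales its reduced multiplication by the determinant. -/
theorem IsReducedMul.det_smul_map_map {ω : (Fin 8 → ℝ) [⋀^Fin 3]→ₗ[ℝ] ℝ}
    {mul : (Fin 8 → ℝ) →ₗ[ℝ] (Fin 8 → ℝ) →ₗ[ℝ] (Fin 8 → ℝ)} (hmul : IsReducedMul ω mul)
    (g : (Fin 8 → ℝ) ≃ₗ[ℝ] (Fin 8 → ℝ)) (hg : formPullback g.toLinearMap ω = ω)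
    (v w : Fin 8 → ℝ) :
    LinearMap.det g.toLinearMap • mul (g v) (g w) = g (mul v w) := by
  rw [IsReducedMul, volForm_eq_basisFun_det] at hmul
  exact smul_mul_map_map hmul basisFun_det_curryLeft_injective g
    (basisFun_det_compLinearMap g.toLinearMap) hg v w

/-- The reduced trace form is scaled by the square of the determinant of an automorphism
fixing `ω`. -/
theorem IsReducedMul.sq_det_mul_reducedTraceForm {ω : (Fin 8 → ℝ) [⋀^Fin 3]→ₗ[ℝ] ℝ}
    {mul : (Fin 8 → ℝ) →ₗ[ℝ] (Fin 8 → ℝ) →ₗ[ℝ] (Fin 8 → ℝ)} (hmul : IsReducedMul ω mul)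
    (g : (Fin 8 → ℝ) ≃ₗ[ℝ] (Fin 8 → ℝ)) (hg : formPullback g.toLinearMap ω = ω)
    (v w : Fin 8 → ℝ) :
    LinearMap.det g.toLinearMap ^ 2 * reducedTraceForm mul (g v) (g w) =
      reducedTraceForm mul v w := by
  have hconj : LinearMap.det g.toLinearMap ^ 2 • (mul (g v) ∘ₗ mul (g w)) =
      g.conj (mul v ∘ₗ mul w) := by
    refine LinearMap.ext fun x => ?_
    obtain ⟨y, rfl⟩ := g.surjective x
    have h := hmul.det_smul_map_map g hg v (mul w y)
    rw [← hmul.det_smul_map_map g hg w y, map_smul, smul_smul, ← sq] at h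
    simpa [LinearEquiv.conj_apply] using h
  rw [reducedTraceForm, reducedTraceForm, ← smul_eq_mul, ← map_smul, hconj,
    LinearMap.trace_conj']

/-- The reduced trace form as a bundled bilinear form. -/
def reducedTraceBilin (mul : (Fin 8 → ℝ) →ₗ[ℝ] (Fin 8 → ℝ) →ₗ[ℝ] (Fin 8 → ℝ)) :
    LinearMap.BilinForm ℝ (Fin 8 → ℝ) :=
  LinearMap.mk₂ ℝ (reducedTraceForm mul)
    (fun _ _ _ => by simp [reducedTraceForm, LinearMap.add_comp])
    (fun _ _ _ => by simp [reducedTraceForm, LinearMap.smul_comp])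
    (fun _ _ _ => by simp [reducedTraceForm, LinearMap.comp_add])
    (fun _ _ _ => by simp [reducedTraceForm, LinearMap.comp_smul])

/-- If `ω` is a non-degenerate 3-form on `ℝ⁸` (its reduced trace form is non-degenerate)
and `g ∈ GL(8,ℝ)` satisfies `g^*ω = ω` and `det g > 0`, then `det g = 1`. -/
theorem det_eq_one_of_fixes_nondegenerate (ω : (Fin 8 → ℝ) [⋀^Fin 3]→ₗ[ℝ] ℝ)
    (mul : (Fin 8 → ℝ) →ₗ[ℝ] (Fin 8 → ℝ) →ₗ[ℝ] (Fin 8 → ℝ)) (hmul : IsReducedMul ω mul)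
    (hnd : ∀ v : Fin 8 → ℝ, (∀ w : Fin 8 → ℝ, reducedTraceForm mul v w = 0) → v = 0)
    (g : (Fin 8 → ℝ) ≃ₗ[ℝ] (Fin 8 → ℝ)) (hg : formPullback g.toLinearMap ω = ω)
    (hdet : 0 < LinearMap.det g.toLinearMap) :
    LinearMap.det g.toLinearMap = 1 := by
  set d := LinearMap.det g.toLinearMap with hd
  set B := reducedTraceBilin mul
  have hB : (LinearMap.BilinForm.toMatrix' B).det ≠ 0 := by
    have hsep : B.SeparatingLeft := hnd
    exact (LinearMap.BilinForm.Nondegenerate.ofSeparatingLeft hsep).toMatrix'.det_ne_zero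
  have hcomp : d ^ 2 • B.comp g.toLinearMap g.toLinearMap = B :=
    LinearMap.ext₂ fun v w => hmul.sq_det_mul_reducedTraceForm g hg v w
  have hdetB := congrArg (fun C => (LinearMap.BilinForm.toMatrix' C).det) hcomp
  simp only [map_smul, LinearMap.BilinForm.toMatrix'_comp, Matrix.det_smul, Matrix.det_mul,
    Matrix.det_transpose, LinearMap.det_toMatrix', Fintype.card_fin, ← hd] at hdetB
  have hpow : d ^ 18 = 1 := mul_right_cancel₀ hB (by linear_combination hdetB)
  exact (pow_eq_one_iff_of_nonneg hdet.le (by norm_num)).1 hpow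
end
end

section
/- Let ω be a non-degenerate 3-form on ℝ^8 and let g ∈ GL(8,ℝ) satisfy g^*ω = ω. Then g preserves the reduced trace form: b^ω(g X, g Y) = b^ω(X, Y) for all X, Y ∈ ℝ^8. -/
noncomputable section

theorem volForm_apply (M : Matrix (Fin 8) (Fin 8) ℝ) : volForm M = M.det :=
  rfl

/-- If the insertion of `m i` into an alternating form vanishes, so does the form at `m`. -/
theorem map_eq_zero_of_curryLeft_eq_zero {V : Type*} [AddCommGroup V] [Module ℝ V] {k : ℕ}
    {θ : V [⋀^Fin (k + 1)]→ₗ[ℝ] ℝ} {m : Fin (k + 1) → V} {i : Fin (k + 1)}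
    (hm : θ.curryLeft (m i) = 0) : θ m = 0 := by
  have hcons : m ∘ Equiv.swap 0 i = Matrix.vecCons (m i) (Fin.tail (m ∘ Equiv.swap 0 i)) := by
    have h0 : (m ∘ Equiv.swap 0 i) 0 = m i := by simp
    rw [← h0]
    exact (Fin.cons_self_tail _).symm
  rw [AlternatingMap.map_congr_perm θ m (Equiv.swap 0 i), hcons,
    ← AlternatingMap.curryLeft_apply_apply, hm, AlternatingMap.zero_apply, smul_zero]

/-- The determinant form is non-degenerate in its first slot. -/
theorem eq_zero_of_curryLeft_eq_zero {k : ℕ} {θ : (Fin (k + 1) → ℝ) [⋀^Fin (k + 1)]→ₗ[ℝ] ℝ}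
    (hθ : ∀ M : Matrix (Fin (k + 1)) (Fin (k + 1)) ℝ, θ M = M.det) {u : Fin (k + 1) → ℝ}
    (hu : θ.curryLeft u = 0) : u = 0 := by
  ext i
  have hrow : (1 : Matrix (Fin (k + 1)) (Fin (k + 1)) ℝ).updateRow i u i = u :=
    Matrix.updateRow_self
  have hzero := map_eq_zero_of_curryLeft_eq_zero (θ := θ)
    (m := (1 : Matrix (Fin (k + 1)) (Fin (k + 1)) ℝ).updateRow i u) (i := i)
    ((congrArg θ.curryLeft hrow).trans hu)
  rw [hθ, ← Matrix.cramer_transpose_apply, Matrix.transpose_one, Matrix.cramer_one,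
    Module.End.one_apply] at hzero
  exact hzero

/-- Pullback scales a top-degree form by the determinant. -/
theorem compLinearMap_eq_det_smul {n : ℕ} {θ : (Fin n → ℝ) [⋀^Fin n]→ₗ[ℝ] ℝ}
    (g : (Fin n → ℝ) →ₗ[ℝ] (Fin n → ℝ)) : θ.compLinearMap g = LinearMap.det g • θ := by
  rw [θ.eq_smul_basis_det (Pi.basisFun ℝ (Fin n))]
  ext v
  simp only [AlternatingMap.compLinearMap_apply, AlternatingMap.smul_apply, smul_eq_mul]
  rw [mul_left_comm]
  exact congrArg _ (Module.Basis.det_comp _ _ _)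

/-- If a linear map scales a form, then it scales the insertions into that form. -/
theorem curryLeft_map_compLinearMap {V : Type*} [AddCommGroup V] [Module ℝ V] {k : ℕ}
    {γ : V [⋀^Fin (k + 1)]→ₗ[ℝ] ℝ} {g : V →ₗ[ℝ] V} {d : ℝ} (h : γ.compLinearMap g = d • γ)
    (u : V) : (γ.curryLeft (g u)).compLinearMap g = d • γ.curryLeft u := by
  rw [← AlternatingMap.curryLeft_compLinearMap, h, AlternatingMap.curryLeft_smul,
    LinearMap.smul_apply]

/-- A linear map preserving `ω` intertwines the forms `(v ⌟ ω) ∧ (w ⌟ ω) ∧ ω`. -/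
theorem awedge_curryLeft_compLinearMap {V : Type*} [AddCommGroup V] [Module ℝ V] {p : ℕ}
    {ω : V [⋀^Fin (p + 1)]→ₗ[ℝ] ℝ} {g : V →ₗ[ℝ] V} (hω : ω.compLinearMap g = ω) (v w : V) :
    (awedge (awedge (ω.curryLeft (g v)) (ω.curryLeft (g w))) ω).compLinearMap g =
      awedge (awedge (ω.curryLeft v) (ω.curryLeft w)) ω := by
  have hcurry (u : V) : (ω.curryLeft (g u)).compLinearMap g = ω.curryLeft u := by
    have h := AlternatingMap.curryLeft_compLinearMap g ω u
    rw [hω] at h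
    exact h.symm
  rw [awedge_compLinearMap, awedge_compLinearMap, hcurry, hcurry, hω]

/-- Suppose `θ` is non-degenerate in its first slot and a multiplication `v·w` is defined by
`(v·w) ⌟ θ = Ω v w`. A linear equivalence that preserves `Ω` and scales `θ` by `d` is then an
automorphism of the multiplication up to the factor `d`. -/
theorem smul_mul_map_of_compLinearMap {V : Type*} [AddCommGroup V] [Module ℝ V] {k : ℕ}
    {θ : V [⋀^Fin (k + 1)]→ₗ[ℝ] ℝ} {Ω : V → V → V [⋀^Fin k]→ₗ[ℝ] ℝ}
    {mul : V →ₗ[ℝ] V →ₗ[ℝ] V} {g : V ≃ₗ[ℝ] V} {d : ℝ}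
    (hθ : ∀ u, θ.curryLeft u = 0 → u = 0) (hmul : ∀ v w, θ.curryLeft (mul v w) = Ω v w)
    (hΩ : ∀ v w, (Ω (g v) (g w)).compLinearMap g.toLinearMap = Ω v w)
    (hd : θ.compLinearMap g.toLinearMap = d • θ) (v w : V) :
    d • mul (g v) (g w) = g (mul v w) := by
  apply g.symm.injective
  rw [← sub_eq_zero]
  apply hθ
  rw [map_sub, sub_eq_zero, g.symm_apply_apply, hmul v w, ← hΩ, ← hmul, map_smul, map_smul,
    ← curryLeft_map_compLinearMap hd, LinearEquiv.coe_coe, g.apply_symm_apply]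

/-- A linear map preserving `ω` is an automorphism, up to its determinant, of the multiplication
that `ω` and the determinant form define. -/
theorem det_smul_mul_map_of_eq_det {θ : (Fin 8 → ℝ) [⋀^Fin 8]→ₗ[ℝ] ℝ}
    (hθ : ∀ M : Matrix (Fin 8) (Fin 8) ℝ, θ M = M.det) {ω : (Fin 8 → ℝ) [⋀^Fin 3]→ₗ[ℝ] ℝ}
    {mul : (Fin 8 → ℝ) →ₗ[ℝ] (Fin 8 → ℝ) →ₗ[ℝ] (Fin 8 → ℝ)}
    (hmul : ∀ v w : Fin 8 → ℝ,
      θ.curryLeft (mul v w) = awedge (awedge (ω.curryLeft v) (ω.curryLeft w)) ω)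
    {g : (Fin 8 → ℝ) ≃ₗ[ℝ] (Fin 8 → ℝ)} (hg : formPullback g.toLinearMap ω = ω)
    (v w : Fin 8 → ℝ) :
    LinearMap.det g.toLinearMap • mul (g v) (g w) = g (mul v w) :=
  smul_mul_map_of_compLinearMap
    (fun _ hu => eq_zero_of_curryLeft_eq_zero (k := 7) hθ hu) hmul
    (awedge_curryLeft_compLinearMap hg) (compLinearMap_eq_det_smul g.toLinearMap) v w

/-- A linear map preserving `ω` is an automorphism of the reduced multiplication
up to its determinant. -/
theorem IsReducedMul.det_smul_mul_map {ω : (Fin 8 → ℝ) [⋀^Fin 3]→ₗ[ℝ] ℝ}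
    {mul : (Fin 8 → ℝ) →ₗ[ℝ] (Fin 8 → ℝ) →ₗ[ℝ] (Fin 8 → ℝ)} (hmul : IsReducedMul ω mul)
    {g : (Fin 8 → ℝ) ≃ₗ[ℝ] (Fin 8 → ℝ)} (hg : formPullback g.toLinearMap ω = ω)
    (v w : Fin 8 → ℝ) :
    LinearMap.det g.toLinearMap • mul (g v) (g w) = g (mul v w) := by
  unfold IsReducedMul at hmul
  -- Replacing `volForm` by an opaque form keeps unification from expanding the determinant.
  obtain ⟨θ, hvol, hdet⟩ : ∃ θ : (Fin 8 → ℝ) [⋀^Fin 8]→ₗ[ℝ] ℝ,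
      θ = volForm ∧ ∀ M : Matrix (Fin 8) (Fin 8) ℝ, θ M = M.det := ⟨volForm, rfl, volForm_apply⟩
  rw [← hvol] at hmul
  exact det_smul_mul_map_of_eq_det hdet hmul hg v w

/-- A linear map preserving `ω` scales the reduced trace form by its squared determinant. -/
theorem IsReducedMul.reducedTraceForm_eq_det_sq_mul {ω : (Fin 8 → ℝ) [⋀^Fin 3]→ₗ[ℝ] ℝ}
    {mul : (Fin 8 → ℝ) →ₗ[ℝ] (Fin 8 → ℝ) →ₗ[ℝ] (Fin 8 → ℝ)} (hmul : IsReducedMul ω mul)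
    {g : (Fin 8 → ℝ) ≃ₗ[ℝ] (Fin 8 → ℝ)} (hg : formPullback g.toLinearMap ω = ω)
    (v w : Fin 8 → ℝ) :
    reducedTraceForm mul v w =
      LinearMap.det g.toLinearMap ^ 2 * reducedTraceForm mul (g v) (g w) := by
  have hconj (u : Fin 8 → ℝ) :
      g.conj (mul u) = LinearMap.det g.toLinearMap • mul (g u) := by
    refine LinearMap.ext fun x => ?_
    rw [LinearEquiv.conj_apply_apply, ← hmul.det_smul_mul_map hg]
    simp
  unfold reducedTraceForm
  rw [← LinearMap.trace_conj' (mul v ∘ₗ mul w) g, LinearEquiv.conj_comp, hconj, hconj,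
    LinearMap.smul_comp, LinearMap.comp_smul, map_smul, map_smul, smul_eq_mul, smul_eq_mul]
  ring

theorem det_toMatrix_reducedTraceBilin_ne_zero
    {mul : (Fin 8 → ℝ) →ₗ[ℝ] (Fin 8 → ℝ) →ₗ[ℝ] (Fin 8 → ℝ)}
    (hnd : ∀ v : Fin 8 → ℝ, (∀ w : Fin 8 → ℝ, reducedTraceForm mul v w = 0) → v = 0) :
    (LinearMap.BilinForm.toMatrix (Pi.basisFun ℝ (Fin 8)) (reducedTraceBilin mul)).det ≠ 0 := by
  rw [← LinearMap.BilinForm.nondegenerate_iff_det_ne_zero]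
  refine ⟨hnd, fun v hv => hnd v fun w => ?_⟩
  exact (LinearMap.trace_mul_comm ℝ (mul v) (mul w)).trans (hv w)

/-- If `ω` is a non-degenerate 3-form on `ℝ⁸` and `g ∈ GL(8,ℝ)` satisfies `g^*ω = ω`,
then `g` preserves the reduced trace form `b^ω`. -/
theorem reducedTraceForm_invariant (ω : (Fin 8 → ℝ) [⋀^Fin 3]→ₗ[ℝ] ℝ)
    (mul : (Fin 8 → ℝ) →ₗ[ℝ] (Fin 8 → ℝ) →ₗ[ℝ] (Fin 8 → ℝ)) (hmul : IsReducedMul ω mul)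
    (hnd : ∀ v : Fin 8 → ℝ, (∀ w : Fin 8 → ℝ, reducedTraceForm mul v w = 0) → v = 0)
    (g : (Fin 8 → ℝ) ≃ₗ[ℝ] (Fin 8 → ℝ)) (hg : formPullback g.toLinearMap ω = ω) :
    ∀ X Y : Fin 8 → ℝ, reducedTraceForm mul (g X) (g Y) = reducedTraceForm mul X Y := by
  intro X Y
  set d := LinearMap.det g.toLinearMap with hd
  set b := Pi.basisFun ℝ (Fin 8)
  have hscale : reducedTraceBilin mul =
      d ^ 2 • (reducedTraceBilin mul).comp g.toLinearMap g.toLinearMap := by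
    refine LinearMap.ext₂ fun v w => ?_
    exact hmul.reducedTraceForm_eq_det_sq_mul hg v w
  have hB := det_toMatrix_reducedTraceBilin_ne_zero hnd
  have hdet := congrArg (fun B => (LinearMap.BilinForm.toMatrix b B).det) hscale
  simp only [map_smul, Matrix.det_smul, LinearMap.BilinForm.toMatrix_comp b b, Matrix.det_mul,
    Matrix.det_transpose, LinearMap.det_toMatrix, Fintype.card_fin, ← hd] at hdet
  have hpow : (d ^ 2) ^ 9 = 1 := by
    apply mul_right_cancel₀ hB
    linear_combination -hdet
  have hsq : d ^ 2 = 1 := (pow_eq_one_iff_of_nonneg (sq_nonneg d) (by norm_num)).mp hpow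
  rw [hmul.reducedTraceForm_eq_det_sq_mul hg X Y, ← hd, hsq, one_mul]
end
end
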